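/- arXiv:2107.13460 — 2 statements merged into one kernel-verified Lean document; each statement's English description precedes it below -/
import Mathlib

section
/- Let γ be a queenon. For all sufficiently small ε > 0 there exists a natural number N with N ≥ ε^{−1/3} such that limsup as n → ∞ of |B_n(γ,ε)|^{1/n} / n is at most exp(H_q^N(γ) + ε^{1/200}). -/
open MeasureTheory Filter Topology
open scoped ENNReal

noncomputable section

/-- The square `[-1/2,1/2]²`. -/
def unitSq : Set (ℝ × ℝ) :=
  Set.Icc (-(1:ℝ)/2) (1/2) ×ˢ Set.Icc (-(1:ℝ)/2) (1/2)

/-- The square `σ_{i,j}^N` (for `i, j ∈ [N]`). -/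
def gridSq (N i j : ℕ) : Set (ℝ × ℝ) :=
  Set.Icc (-(1:ℝ)/2 + ((i:ℝ) - 1)/N) (-(1:ℝ)/2 + (i:ℝ)/N) ×ˢ
    Set.Icc (-(1:ℝ)/2 + ((j:ℝ) - 1)/N) (-(1:ℝ)/2 + (j:ℝ)/N)

/-- The cell of the partition `I_N` with index `i, j ∈ [2N]`. -/
def INcell (N i j : ℕ) : Set (ℝ × ℝ) :=
  {p ∈ unitSq | (-1 + ((i:ℝ) - 1)/N ≤ p.1 + p.2 ∧ p.1 + p.2 ≤ -1 + (i:ℝ)/N) ∧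
    (-1 + ((j:ℝ) - 1)/N ≤ p.2 - p.1 ∧ p.2 - p.1 ≤ -1 + (j:ℝ)/N)}

/-- The interval of the partition `J_N` of `[-1,1]` with index `i ∈ [2N]`. -/
def JNcell (N i : ℕ) : Set ℝ :=
  Set.Icc (-1 + ((i:ℝ) - 1)/N) (-1 + (i:ℝ)/N)

/-- A member of the family `R` of subsets of the square. -/
def Rset (a₁ b₁ a₂ b₂ : ℝ) : Set (ℝ × ℝ) :=
  {p ∈ unitSq | (a₁ ≤ p.1 + p.2 ∧ p.1 + p.2 ≤ b₁) ∧ (a₂ ≤ p.2 - p.1 ∧ p.2 - p.1 ≤ b₂)}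

/-- The distance `d` between two Borel measures on the square: the supremum of
`|γ₁(α) − γ₂(α)|` over `α ∈ R`. -/
def qdist (μ ν : Measure (ℝ × ℝ)) : ℝ :=
  sSup {t : ℝ | ∃ a₁ b₁ a₂ b₂ : ℝ, a₁ ∈ Set.Icc (-1:ℝ) 1 ∧ b₁ ∈ Set.Icc (-1:ℝ) 1 ∧
    a₂ ∈ Set.Icc (-1:ℝ) 1 ∧ b₂ ∈ Set.Icc (-1:ℝ) 1 ∧
    t = |(μ (Rset a₁ b₁ a₂ b₂)).toReal - (ν (Rset a₁ b₁ a₂ b₂)).toReal|}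

/-- A permuton: a Borel probability measure on the square with uniform marginals. -/
def IsPermuton (μ : Measure (ℝ × ℝ)) : Prop :=
  IsProbabilityMeasure μ ∧ μ unitSqᶜ = 0 ∧
  ∀ a b : ℝ, -(1:ℝ)/2 ≤ a → a ≤ b → b ≤ 1/2 →
    μ (Set.Icc a b ×ˢ Set.Icc (-(1:ℝ)/2) (1/2)) = ENNReal.ofReal (b - a) ∧
    μ (Set.Icc (-(1:ℝ)/2) (1/2) ×ˢ Set.Icc a b) = ENNReal.ofReal (b - a)

/-- An `N`-step permuton: a permuton with constant density on each square `σ_{i,j}^N`. -/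
def IsStepPermutonN (N : ℕ) (μ : Measure (ℝ × ℝ)) : Prop :=
  IsPermuton μ ∧
  ∀ i ∈ Finset.Icc 1 N, ∀ j ∈ Finset.Icc 1 N, ∃ c : ℝ≥0∞,
    ∀ s : Set (ℝ × ℝ), s ⊆ gridSq N i j → MeasurableSet s → μ s = c * volume s

/-- A step permuton. -/
def IsStepPermuton (μ : Measure (ℝ × ℝ)) : Prop :=
  ∃ N : ℕ, 0 < N ∧ IsStepPermutonN N μ

/-- Sub-uniform diagonal marginals. -/
def SubUniformDiag (μ : Measure (ℝ × ℝ)) : Prop :=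
  ∀ a b : ℝ, -1 ≤ a → a ≤ b → b ≤ 1 →
    μ {p ∈ unitSq | a ≤ p.1 + p.2 ∧ p.1 + p.2 ≤ b} ≤ ENNReal.ofReal (b - a) ∧
    μ {p ∈ unitSq | a ≤ p.2 - p.1 ∧ p.2 - p.1 ≤ b} ≤ ENNReal.ofReal (b - a)

/-- The set `Γ` of queenons: the closure, in the topology of weak convergence of Borel
probability measures, of the set of step permutons with sub-uniform diagonal marginals. -/
def queenons : Set (ProbabilityMeasure (ℝ × ℝ)) :=
  closure {μ : ProbabilityMeasure (ℝ × ℝ) |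
    IsStepPermuton μ.toMeasure ∧ SubUniformDiag μ.toMeasure}

/-- The pushforward `γ⁺` of `γ` under `(x,y) ↦ x+y`. -/
def diagPlus (γ : Measure (ℝ × ℝ)) : Measure ℝ := γ.map fun p => p.1 + p.2

/-- The pushforward `γ⁻` of `γ` under `(x,y) ↦ y−x`. -/
def diagMinus (γ : Measure (ℝ × ℝ)) : Measure ℝ := γ.map fun p => p.2 - p.1

/-- The measure `γ̄⁺` on `[-1,1]`, with `γ̄⁺([a,b]) = (b−a) − γ⁺([a,b])`. -/
def barPlus (γ : Measure (ℝ × ℝ)) : Measure ℝ :=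
  volume.restrict (Set.Icc (-1:ℝ) 1) - diagPlus γ

/-- The measure `γ̄⁻` on `[-1,1]`, with `γ̄⁻([a,b]) = (b−a) − γ⁻([a,b])`. -/
def barMinus (γ : Measure (ℝ × ℝ)) : Measure ℝ :=
  volume.restrict (Set.Icc (-1:ℝ) 1) - diagMinus γ

/-- The uniform probability measure on `[-1,1]` (density `1/2`). -/
def unif11 : Measure ℝ := (2 : ℝ≥0∞)⁻¹ • volume.restrict (Set.Icc (-1:ℝ) 1)

open Classical in
/-- The Kullback–Leibler divergence of `μ` with respect to `ν`, as an extended real: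
`∫ log (dμ/dν) dμ` if `μ ≪ ν` and the integrand is integrable, and `+∞` otherwise. -/
def DKL {X : Type*} [MeasurableSpace X] (μ ν : Measure X) : EReal :=
  if μ ≪ ν ∧ Integrable (fun x => Real.log (μ.rnDeriv ν x).toReal) μ then
    ((∫ x, Real.log (μ.rnDeriv ν x).toReal ∂μ : ℝ) : EReal)
  else ⊤

/-- The Q-entropy `H_q(γ) = −D_KL(γ) − D_KL(γ̄⁺) − D_KL(γ̄⁻) + 2 log 2 − 3`. -/
def Hq (γ : Measure (ℝ × ℝ)) : EReal :=
  -DKL γ (volume.restrict unitSq) - DKL (barPlus γ) unif11 - DKL (barMinus γ) unif11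
    + ((2 * Real.log 2 - 3 : ℝ) : EReal)

/-- The discrete approximation `H_q^N` of the Q-entropy. -/
def HqN (N : ℕ) (γ : Measure (ℝ × ℝ)) : ℝ :=
  -(∑ i ∈ Finset.Icc 1 (2*N), ∑ j ∈ Finset.Icc 1 (2*N),
      (γ (INcell N i j)).toReal *
        Real.log ((γ (INcell N i j)).toReal / (volume (INcell N i j)).toReal))
  - (∑ i ∈ Finset.Icc 1 (2*N),
      (barPlus γ (JNcell N i)).toReal *
        Real.log ((2*N : ℝ) * (barPlus γ (JNcell N i)).toReal))
  - (∑ i ∈ Finset.Icc 1 (2*N),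
      (barMinus γ (JNcell N i)).toReal *
        Real.log ((2*N : ℝ) * (barMinus γ (JNcell N i)).toReal))
  + 2 * Real.log 2 - 3

/-- An `n`-queens configuration: a subset of `[n]² = {1,…,n}²` with exactly one element in
each row and column and at most one element in each plus- and minus-diagonal. -/
def IsQueensConfig (n : ℕ) (q : Finset (ℕ × ℕ)) : Prop :=
  (∀ p ∈ q, p.1 ∈ Finset.Icc 1 n ∧ p.2 ∈ Finset.Icc 1 n) ∧
  (∀ y ∈ Finset.Icc 1 n, ∃! x : ℕ, (x, y) ∈ q) ∧
  (∀ x ∈ Finset.Icc 1 n, ∃! y : ℕ, (x, y) ∈ q) ∧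
  (∀ p ∈ q, ∀ p' ∈ q, p.1 + p.2 = p'.1 + p'.2 → p = p') ∧
  (∀ p ∈ q, ∀ p' ∈ q, (p.2 : ℤ) - (p.1 : ℤ) = (p'.2 : ℤ) - (p'.1 : ℤ) → p = p')

/-- `Q(n)`, the number of `n`-queens configurations. -/
def numQueens (n : ℕ) : ℕ :=
  Set.ncard {q : Finset (ℕ × ℕ) | IsQueensConfig n q}

/-- The measure `γ_q` associated to an `n`-queens configuration `q`: density `n` on each
square `σ_{i,j}^n` with `(i,j) ∈ q`, and `0` elsewhere. -/
def gammaOf (n : ℕ) (q : Finset (ℕ × ℕ)) : Measure (ℝ × ℝ) :=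
  volume.withDensity ((⋃ ij ∈ q, gridSq n ij.1 ij.2).indicator fun _ => (n : ℝ≥0∞))

/-- The set `B_n(γ,ε)` of `n`-queens configurations `q` with `d(γ_q, γ) < ε`. -/
def Bset (n : ℕ) (γ : Measure (ℝ × ℝ)) (ε : ℝ) : Set (Finset (ℕ × ℕ)) :=
  {q | IsQueensConfig n q ∧ qdist (gammaOf n q) γ < ε}

/-- `|B_n(γ,ε)|`. -/
def Bcard (n : ℕ) (γ : Measure (ℝ × ℝ)) (ε : ℝ) : ℕ := (Bset n γ ε).ncard

/-- The exponential of an extended real, with `exp(−∞) = 0`. -/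
def expEReal (x : EReal) : ℝ := if x = ⊥ then 0 else Real.exp x.toReal

section Counting

open Finset

theorem sum_powersetCard_succ_erase {V : Type*} [DecidableEq V] (q : Finset V) (k : ℕ)
    (g : Finset V → V → ℝ) :
    ∑ A ∈ q.powersetCard (k + 1), ∑ x ∈ A, g (A.erase x) x =
      ∑ A ∈ q.powersetCard k, ∑ x ∈ q \ A, g A x := by
  rw [Finset.sum_sigma', Finset.sum_sigma']
  refine Finset.sum_bij' (fun a _ => ⟨a.1.erase a.2, a.2⟩) (fun a _ => ⟨insert a.2 a.1, a.2⟩)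
    ?_ ?_ ?_ ?_ ?_
  · rintro ⟨A, x⟩ h
    simp only [mem_sigma, mem_powersetCard, Finset.mem_sdiff] at h ⊢
    obtain ⟨⟨hA, hc⟩, hx⟩ := h
    refine ⟨⟨(erase_subset _ _).trans hA, ?_⟩, hA hx, by simp⟩
    rw [card_erase_of_mem hx, hc]; rfl
  · rintro ⟨A, x⟩ h
    simp only [mem_sigma, mem_powersetCard, Finset.mem_sdiff] at h ⊢
    obtain ⟨⟨hA, hc⟩, hx, hxA⟩ := h
    exact ⟨⟨insert_subset hx hA, by rw [card_insert_of_notMem hxA, hc]⟩, mem_insert_self _ _⟩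
  · rintro ⟨A, x⟩ h
    simp only [mem_sigma] at h
    simp [insert_erase h.2]
  · rintro ⟨A, x⟩ h
    simp only [mem_sigma, Finset.mem_sdiff] at h
    simp [erase_insert h.2.2]
  · intros; rfl

/-- Probability that sequential sampling, which adds `x` to the current `k`-set `A` with
probability `p k A x`, produces the set `A`. -/
def reachProb {V : Type*} [DecidableEq V] (p : ℕ → Finset V → V → ℝ) : ℕ → Finset V → ℝ
  | 0, _ => 1
  | k + 1, A => ∑ x ∈ A, reachProb p k (A.erase x) * p k (A.erase x) x

theorem sum_reachProb_le_one {V : Type*} [DecidableEq V] {p : ℕ → Finset V → V → ℝ}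
    (X : Finset V) (hp : ∀ k A x, 0 ≤ p k A x) (hp1 : ∀ k A, ∑ x ∈ X \ A, p k A x ≤ 1) (k : ℕ) :
    (∀ A, 0 ≤ reachProb p k A) ∧ ∑ A ∈ X.powersetCard k, reachProb p k A ≤ 1 := by
  induction k with
  | zero => simp [reachProb]
  | succ k ih =>
    refine ⟨fun A => Finset.sum_nonneg fun x _ => mul_nonneg (ih.1 _) (hp _ _ _), ?_⟩
    simp only [reachProb]
    rw [sum_powersetCard_succ_erase X k fun A x => reachProb p k A * p k A x]
    refine le_trans (Finset.sum_le_sum fun A _ => ?_) ih.2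
    rw [← Finset.mul_sum]
    exact mul_le_of_le_one_right (ih.1 _) (hp1 _ _)

theorem reachProb_pos {V : Type*} [DecidableEq V] {p : ℕ → Finset V → V → ℝ} {q : Finset V}
    (hp : ∀ k, ∀ A ⊆ q, ∀ x ∈ q \ A, 0 < p k A x) (k : ℕ) :
    ∀ A ∈ q.powersetCard k, 0 < reachProb p k A := by
  induction k with
  | zero => simp [reachProb]
  | succ k ih =>
    intro A hA
    rw [mem_powersetCard] at hA
    refine Finset.sum_pos (fun x hx => mul_pos (ih _ ?_) (hp _ _ ?_ _ ?_)) ?_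
    · rw [mem_powersetCard, card_erase_of_mem hx, hA.2]
      exact ⟨(erase_subset _ _).trans hA.1, rfl⟩
    · exact (erase_subset _ _).trans hA.1
    · simp [hA.1 hx]
    · rw [← card_pos]; omega

theorem log_sum_ge {V : Type*} (s : Finset V) (hs : s.Nonempty) (f : V → ℝ)
    (hf : ∀ x ∈ s, 0 < f x) :
    Real.log #s + (∑ x ∈ s, Real.log (f x)) / #s ≤ Real.log (∑ x ∈ s, f x) := by
  have hc : (0 : ℝ) < #s := by exact_mod_cast card_pos.2 hs
  have h := strictConcaveOn_log_Ioi.concaveOn.le_map_sum (t := s) (w := fun _ => (#s : ℝ)⁻¹)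
    (p := f) (fun _ _ => by positivity) (by simp [hc.ne']) (fun x hx => hf x hx)
  simp only [smul_eq_mul, ← Finset.mul_sum] at h
  rw [Real.log_mul (by positivity) (Finset.sum_pos hf hs).ne', Real.log_inv] at h
  rw [div_eq_inv_mul]; linarith

theorem sum_log_le_card_mul_log {V : Type*} (s : Finset V) (hs : s.Nonempty) (f : V → ℝ)
    (hf : ∀ x ∈ s, 0 < f x) {C : ℝ} (hC : ∑ x ∈ s, f x ≤ #s * C) (hC0 : 0 < C) :
    ∑ x ∈ s, Real.log (f x) ≤ #s * Real.log C := by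
  have hc : (0 : ℝ) < #s := by exact_mod_cast card_pos.2 hs
  have h := log_sum_ge s hs f hf
  have h2 := Real.log_le_log (Finset.sum_pos hf hs) hC
  rw [Real.log_mul hc.ne' hC0.ne'] at h2
  have : (∑ x ∈ s, Real.log (f x)) / #s ≤ Real.log C := by linarith
  rw [div_le_iff₀ hc] at this
  linarith

theorem sum_log_reachProb_ge {V : Type*} [DecidableEq V] {p : ℕ → Finset V → V → ℝ}
    {q : Finset V} {n : ℕ} (hq : #q = n)
    (hp : ∀ k, ∀ A ⊆ q, ∀ x ∈ q \ A, 0 < p k A x) (c : ℕ → ℝ)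
    (hc : ∀ k < n, (n.choose k * (n - k) : ℝ) * c k ≤
      ∑ A ∈ q.powersetCard k, ∑ x ∈ q \ A, Real.log (p k A x)) (k : ℕ) (hk : k ≤ n) :
    (n.choose k : ℝ) * (Real.log k.factorial + ∑ i ∈ range k, c i) ≤
      ∑ A ∈ q.powersetCard k, Real.log (reachProb p k A) := by
  induction k with
  | zero => simp [reachProb]
  | succ k ih =>
    have hkn : (0 : ℝ) < n - k := by
      have : ((k + 1 : ℕ) : ℝ) ≤ n := by exact_mod_cast hk
      push_cast at this; linarith
    have hch : (n.choose (k + 1) : ℝ) * (k + 1) = n.choose k * (n - k) := by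
      have := Nat.choose_succ_right_eq n k
      rw [← Nat.cast_sub (by omega)]
      exact_mod_cast this
    have h1 : ∀ A ∈ q.powersetCard (k + 1), Real.log (k + 1) + (∑ x ∈ A,
        (Real.log (reachProb p k (A.erase x)) + Real.log (p k (A.erase x) x))) / (k + 1) ≤
        Real.log (reachProb p (k + 1) A) := by
      intro A hA
      rw [mem_powersetCard] at hA
      have hne : A.Nonempty := by rw [← card_pos]; omega
      have pos1 : ∀ x ∈ A, 0 < reachProb p k (A.erase x) := fun x hx => by
        apply reachProb_pos hp
        rw [mem_powersetCard, card_erase_of_mem hx, hA.2]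
        exact ⟨(erase_subset _ _).trans hA.1, rfl⟩
      have pos2 : ∀ x ∈ A, 0 < p k (A.erase x) x := fun x hx =>
        hp _ _ ((erase_subset _ _).trans hA.1) _ (by simp [hA.1 hx])
      have := log_sum_ge A hne (fun x => reachProb p k (A.erase x) * p k (A.erase x) x)
        (fun x hx => mul_pos (pos1 x hx) (pos2 x hx))
      rw [hA.2] at this
      rw [Finset.sum_congr rfl fun x hx => Real.log_mul (pos1 x hx).ne' (pos2 x hx).ne'] at this
      push_cast at this
      exact this
    have h2 := Finset.sum_le_sum h1
    rw [Finset.sum_add_distrib, ← Finset.sum_div, sum_const, card_powersetCard, hq, nsmul_eq_mul,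
      sum_powersetCard_succ_erase q k fun A x =>
        Real.log (reachProb p k A) + Real.log (p k A x)] at h2
    simp only [Finset.sum_add_distrib] at h2
    have h3 : ∑ A ∈ q.powersetCard k, ∑ x ∈ q \ A, Real.log (reachProb p k A) =
        (n - k) * ∑ A ∈ q.powersetCard k, Real.log (reachProb p k A) := by
      rw [Finset.mul_sum]
      refine Finset.sum_congr rfl fun A hA => ?_
      rw [mem_powersetCard] at hA
      rw [sum_const, card_sdiff_of_subset hA.1, hA.2, hq, nsmul_eq_mul,
        Nat.cast_sub (by omega)]
    rw [h3] at h2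
    refine le_trans ?_ h2
    have h4 := ih (by omega)
    have h5 := hc k (by omega)
    have h6 := mul_le_mul_of_nonneg_left h4 hkn.le
    rw [Finset.sum_range_succ, Nat.factorial_succ, Nat.cast_mul, Real.log_mul (by positivity)
      (by positivity)]
    have hk1 : (0 : ℝ) < k + 1 := by positivity
    have h7 : (n.choose (k + 1) : ℝ) * (Real.log k.factorial + ∑ i ∈ range k, c i + c k) ≤
        ((n - k) * ∑ A ∈ q.powersetCard k, Real.log (reachProb p k A) +
          ∑ A ∈ q.powersetCard k, ∑ x ∈ q \ A, Real.log (p k A x)) / (k + 1) := by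
      rw [le_div_iff₀ hk1]
      calc _ = (n.choose (k + 1) * (k + 1) : ℝ) *
            (Real.log k.factorial + ∑ i ∈ range k, c i + c k) := by ring
        _ = (n - k) * (n.choose k * (Real.log k.factorial + ∑ i ∈ range k, c i)) +
            n.choose k * (n - k) * c k := by rw [hch]; ring
        _ ≤ _ := by linarith
    push_cast
    linarith

/-- Revealing the elements of each set of a family in a uniformly random order, and predicting the
next one among the available elements with probability proportional to `w k`. -/
theorem card_mul_exp_le_one {V : Type*} [DecidableEq V] {n : ℕ} (hn : 0 < n) (X : Finset V)
    (F : Finset (Finset V)) (hF : ∀ q ∈ F, q ⊆ X ∧ #q = n) (avail : Finset V → Finset V)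
    (hav : ∀ A, avail A ⊆ X) (hav' : ∀ q ∈ F, ∀ A ⊆ q, q \ A ⊆ avail A)
    (w : ℕ → V → ℝ) (hw : ∀ k x, 0 ≤ w k x) (hw' : ∀ k, ∀ q ∈ F, ∀ x ∈ q, 0 < w k x)
    (hZ : ∀ q ∈ F, ∀ k < n, ∑ A ∈ q.powersetCard k, ∑ x ∈ avail A, w k x ≤ n.choose k * n)
    (c : ℝ) (hc : ∀ q ∈ F, n * c ≤ ∑ k ∈ range n, ∑ x ∈ q, Real.log (w k x)) :
    (#F : ℝ) * Real.exp (Real.log n.factorial - n * Real.log n + c) ≤ 1 := by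
  set Z : ℕ → Finset V → ℝ := fun k A => ∑ x ∈ avail A, w k x with hZdef
  set p : ℕ → Finset V → V → ℝ := fun k A x => if x ∈ avail A then w k x / Z k A else 0 with hp
  have hn' : (0 : ℝ) < n := by exact_mod_cast hn
  have Znn : ∀ k A, 0 ≤ Z k A := fun k A => Finset.sum_nonneg fun x _ => hw k x
  have p_nn : ∀ k A x, 0 ≤ p k A x := fun k A x => by
    simp only [hp]; split_ifs
    exacts [div_nonneg (hw _ _) (Znn _ _), le_rfl]
  have p_sum : ∀ k A, ∑ x ∈ X \ A, p k A x ≤ 1 := fun k A => by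
    calc ∑ x ∈ X \ A, p k A x ≤ ∑ x ∈ X, p k A x :=
          Finset.sum_le_sum_of_subset_of_nonneg sdiff_subset fun x _ _ => p_nn _ _ _
      _ = ∑ x ∈ avail A, w k x / Z k A := by
          simp only [hp]
          rw [← Finset.sum_filter]
          refine Finset.sum_congr ?_ fun _ _ => rfl
          ext x
          simp only [mem_filter]
          exact ⟨fun h => h.2, fun h => ⟨hav A h, h⟩⟩
      _ = Z k A / Z k A := by rw [← Finset.sum_div]
      _ ≤ 1 := div_self_le_one _
  have key : ∀ q ∈ F, Real.exp (Real.log n.factorial - n * Real.log n + c) ≤ reachProb p n q := by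
    intro q hq
    have Zpos : ∀ k, ∀ A ⊆ q, ∀ x ∈ q \ A, 0 < Z k A := fun k A hA x hx =>
      Finset.sum_pos' (fun _ _ => hw _ _) ⟨x, hav' q hq A hA hx,
        hw' k q hq x (Finset.mem_sdiff.1 hx).1⟩
    have p_pos : ∀ k, ∀ A ⊆ q, ∀ x ∈ q \ A, 0 < p k A x := fun k A hA x hx => by
      simp only [hp]
      rw [if_pos (hav' q hq A hA hx)]
      exact div_pos (hw' k q hq x (Finset.mem_sdiff.1 hx).1) (Zpos k A hA x hx)
    have hcard := (hF q hq).2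
    have step := sum_log_reachProb_ge hcard p_pos
      (fun k => (∑ x ∈ q, Real.log (w k x)) / n - Real.log n) ?_ n le_rfl
    · rw [Finset.sum_sub_distrib, ← Finset.sum_div, sum_const, card_range, nsmul_eq_mul,
        Nat.choose_self, ← hcard, powersetCard_self, sum_singleton, hcard] at step
      have pos := reachProb_pos p_pos n q (by simp [hcard])
      rw [← Real.le_log_iff_exp_le pos]
      refine le_trans ?_ step
      have := hc q hq
      have h2 : c ≤ (∑ k ∈ range n, ∑ x ∈ q, Real.log (w k x)) / n := by
        rw [le_div_iff₀ hn']; linarith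
      push_cast
      linarith
    · intro k hk
      have hkn : (0 : ℝ) < n - k := by
        have : ((k : ℕ) : ℝ) < n := by exact_mod_cast hk
        linarith
      have nonempty_sdiff : ∀ A ∈ q.powersetCard k, (q \ A).Nonempty := fun A hA => by
        rw [mem_powersetCard] at hA
        rw [← card_pos, card_sdiff_of_subset hA.1]; omega
      have e1 : ∀ A ∈ q.powersetCard k, ∑ x ∈ q \ A, Real.log (p k A x) =
          ∑ x ∈ q \ A, Real.log (w k x) - (n - k) * Real.log (Z k A) := by
        intro A hA
        rw [mem_powersetCard] at hA
        have : ∀ x ∈ q \ A, Real.log (p k A x) = Real.log (w k x) - Real.log (Z k A) := by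
          intro x hx
          simp only [hp]
          rw [if_pos (hav' q hq A hA.1 hx), Real.log_div
            (hw' k q hq x (Finset.mem_sdiff.1 hx).1).ne' (Zpos k A hA.1 x hx).ne']
        rw [Finset.sum_congr rfl this, Finset.sum_sub_distrib, sum_const,
          card_sdiff_of_subset hA.1, hA.2, hcard, nsmul_eq_mul, Nat.cast_sub hk.le]
      rw [Finset.sum_congr rfl e1, Finset.sum_sub_distrib, ← Finset.mul_sum]
      have e2 : ∑ A ∈ q.powersetCard k, ∑ x ∈ q \ A, Real.log (w k x) =
          (n.choose k * (n - k) : ℝ) * ((∑ x ∈ q, Real.log (w k x)) / n) := by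
        have h1 : ∑ A ∈ q.powersetCard k, ∑ x ∈ q \ A, Real.log (w k x) =
            ∑ x ∈ q, ∑ A ∈ (q.erase x).powersetCard k, Real.log (w k x) := by
          apply Finset.sum_comm'
          intro A x
          simp only [mem_powersetCard, Finset.mem_sdiff, subset_erase]
          tauto
        have hch : ((n - 1).choose k : ℝ) * n = n.choose k * (n - k) := by
          have := Nat.choose_mul_succ_eq (n - 1) k
          rw [Nat.sub_add_cancel hn] at this
          rw [← Nat.cast_sub (by omega)]
          exact_mod_cast this
        rw [h1, Finset.sum_congr rfl fun x hx => by
          rw [sum_const, card_powersetCard, card_erase_of_mem hx, hcard, nsmul_eq_mul],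
          ← Finset.mul_sum, ← hch]
        field_simp
      have e3 := sum_log_le_card_mul_log (q.powersetCard k)
        (powersetCard_nonempty.2 (by omega)) (Z k)
        (fun A hA => by
          obtain ⟨x, hx⟩ := nonempty_sdiff A hA
          exact Zpos k A (mem_powersetCard.1 hA).1 x hx)
        (C := n) (by rw [card_powersetCard, hcard]; exact hZ q hq k hk) hn'
      rw [card_powersetCard, hcard] at e3
      rw [e2]
      have := mul_le_mul_of_nonneg_left e3 hkn.le
      linarith
  calc (#F : ℝ) * Real.exp (Real.log n.factorial - n * Real.log n + c)
      = ∑ q ∈ F, Real.exp (Real.log n.factorial - n * Real.log n + c) := by simp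
    _ ≤ ∑ q ∈ F, reachProb p n q := Finset.sum_le_sum key
    _ ≤ ∑ q ∈ X.powersetCard n, reachProb p n q :=
        Finset.sum_le_sum_of_subset_of_nonneg (fun q hq => mem_powersetCard.2 (hF q hq))
          fun q _ _ => (sum_reachProb_le_one X p_nn p_sum n).1 q
    _ ≤ 1 := (sum_reachProb_le_one X p_nn p_sum n).2

theorem choose_sub_le {n k : ℕ} (hk : k < n) (j : ℕ) (hj : j ≤ n) :
    ((n - j).choose k : ℝ) ≤ n.choose k * (1 - (k : ℝ) / n) ^ j := by
  have hn : (0 : ℝ) < n := by exact_mod_cast (by omega : 0 < n)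
  have ht : (0 : ℝ) ≤ 1 - (k : ℝ) / n := by
    rw [sub_nonneg, div_le_one hn]; exact_mod_cast hk.le
  induction j with
  | zero => simp
  | succ j ih =>
    rcases lt_or_ge (n - (j + 1)) k with h | h
    · rw [Nat.choose_eq_zero_of_lt h]
      push_cast; positivity
    · have e := Nat.choose_mul_succ_eq (n - (j + 1)) k
      have e1 : n - (j + 1) + 1 = n - j := by omega
      rw [e1] at e
      have e2 : (((n - (j + 1)).choose k : ℕ) : ℝ) * (n - j) = (n - j).choose k * (n - j - k) := by
        have : (((n - j : ℕ) : ℕ) : ℝ) = n - j := by rw [Nat.cast_sub (by omega)]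
        have h3 : (((n - j - k : ℕ) : ℕ) : ℝ) = n - j - k := by
          rw [Nat.cast_sub (by omega), Nat.cast_sub (by omega)]
        rw [← h3, ← this]
        exact_mod_cast e
      have hnj : (0 : ℝ) < n - j := by
        rw [sub_pos]; exact_mod_cast (by omega : j < n)
      have e3 : (((n - (j + 1)).choose k : ℕ) : ℝ) ≤ (n - j).choose k * (1 - (k : ℝ) / n) := by
        have : (((n - (j + 1)).choose k : ℕ) : ℝ) = (n - j).choose k * (1 - k / (n - j)) := by
          field_simp
          linarith
        rw [this]
        gcongr
        simp
      calc _ ≤ _ := e3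
        _ ≤ n.choose k * (1 - (k : ℝ) / n) ^ j * (1 - (k : ℝ) / n) := by
          gcongr; exact ih (by omega)
        _ = _ := by ring

/-- Two squares of the board that share a row, a column or a diagonal. -/
def Attacks (x a : ℕ × ℕ) : Prop :=
  x.1 = a.1 ∨ x.2 = a.2 ∨ x.1 + x.2 = a.1 + a.2 ∨ x.2 + a.1 = a.2 + x.1

instance : DecidableRel Attacks := fun _ _ => by unfold Attacks; infer_instance

/-- The index of the plus-diagonal through a square of the board. -/
def plusIdx (x : ℕ × ℕ) : ℕ := x.1 + x.2 - 1

/-- The index of the minus-diagonal through a square of the `n × n` board. -/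
def minusIdx (n : ℕ) (x : ℕ × ℕ) : ℕ := n + x.2 - x.1

/-- The `n × n` board. -/
def board (n : ℕ) : Finset (ℕ × ℕ) := Icc 1 n ×ˢ Icc 1 n

theorem mem_board {n : ℕ} {x : ℕ × ℕ} :
    x ∈ board n ↔ (1 ≤ x.1 ∧ x.1 ≤ n) ∧ (1 ≤ x.2 ∧ x.2 ≤ n) := by
  simp [board]

theorem IsQueensConfig.subset_board {n : ℕ} {q : Finset (ℕ × ℕ)} (h : IsQueensConfig n q) :
    q ⊆ board n := fun p hp => by
  have := h.1 p hp
  simpa [mem_board] using this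

theorem IsQueensConfig.card {n : ℕ} {q : Finset (ℕ × ℕ)} (h : IsQueensConfig n q) : #q = n := by
  have : #q = #(Icc 1 n) := by
    refine Finset.card_bij (fun p _ => p.1) (fun p hp => (h.1 p hp).1) ?_ ?_
    · intro a ha b hb hab
      obtain ⟨y, _, hy⟩ := h.2.2.1 a.1 (h.1 a ha).1
      have h1 := hy a.2 ha
      have h2 := hy b.2 (by rw [hab]; exact hb)
      exact Prod.ext hab (h1.trans h2.symm)
    · intro x hx
      obtain ⟨y, hy, _⟩ := h.2.2.1 x hx
      exact ⟨(x, y), hy, rfl⟩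
  simpa using this

theorem IsQueensConfig.eq_of_attacks {n : ℕ} {q : Finset (ℕ × ℕ)} (h : IsQueensConfig n q)
    {x a : ℕ × ℕ} (hx : x ∈ q) (ha : a ∈ q) (hxa : Attacks x a) : x = a := by
  rcases hxa with e | e | e | e
  · obtain ⟨y, _, hy⟩ := h.2.2.1 a.1 (h.1 a ha).1
    have h1 := hy a.2 ha
    have h2 := hy x.2 (by rw [← e]; exact hx)
    exact Prod.ext e (h2.trans h1.symm)
  · obtain ⟨y, _, hy⟩ := h.2.1 a.2 (h.1 a ha).2
    have h1 := hy a.1 ha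
    have h2 := hy x.1 (by rw [← e]; exact hx)
    exact Prod.ext (h2.trans h1.symm) e
  · exact h.2.2.2.1 x hx a ha e
  · exact h.2.2.2.2 x hx a ha (by omega)

theorem eq_of_attacks_twice {x a : ℕ × ℕ} (h1 : x.1 = a.1 ∨ x.2 = a.2) (h2 : x ≠ a)
    (h3 : x.1 + x.2 = a.1 + a.2 ∨ x.2 + a.1 = a.2 + x.1) : False := by
  apply h2
  ext <;> omega

/-- Upper bound for the probability that `x` is not attacked after a proportion `t` of the queens
of `q` has been revealed. -/
noncomputable def availBound (n : ℕ) (q : Finset (ℕ × ℕ)) (t : ℝ) (x : ℕ × ℕ) : ℝ :=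
  if x ∈ q then 1 - t else
    (1 - t) ^ 2 * ((1 - if plusIdx x ∈ q.image plusIdx then t else 0) *
      (1 - if minusIdx n x ∈ q.image (minusIdx n) then t else 0))

theorem pow_card_attackers_le {n : ℕ} {q : Finset (ℕ × ℕ)} (h : IsQueensConfig n q)
    {x : ℕ × ℕ} (hx : x ∈ board n) {t : ℝ} (ht0 : 0 ≤ t) (ht : t ≤ 1) :
    (1 - t) ^ #(q.filter (Attacks x)) ≤ availBound n q t x := by
  have h0 : 0 ≤ 1 - t := by linarith
  have h1 : 1 - t ≤ 1 := by linarith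
  unfold availBound
  rw [mem_board] at hx
  split_ifs with hq hp hm hm
  · have : 1 ≤ #(q.filter (Attacks x)) :=
      card_pos.2 ⟨x, mem_filter.2 ⟨hq, Or.inl rfl⟩⟩
    simpa using pow_le_pow_of_le_one h0 h1 this
  all_goals
    obtain ⟨y, hy, _⟩ := h.2.2.1 x.1 (by simp; omega)
    obtain ⟨z, hz, _⟩ := h.2.1 x.2 (by simp; omega)
    set a : ℕ × ℕ := (x.1, y) with ha
    set b : ℕ × ℕ := (z, x.2) with hb
    have hxa : x ≠ a := fun e => hq (e ▸ hy)
    have hxb : x ≠ b := fun e => hq (e ▸ hz)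
    have hab : a ≠ b := fun e => hxa (by
      ext
      · rfl
      · have := congrArg Prod.snd e; simpa [ha, hb] using this.symm)
    have haF : a ∈ q.filter (Attacks x) := mem_filter.2 ⟨hy, Or.inl rfl⟩
    have hbF : b ∈ q.filter (Attacks x) := mem_filter.2 ⟨hz, Or.inr (Or.inl rfl)⟩
    have hplus : plusIdx x ∈ q.image plusIdx → ∃ c ∈ q.filter (Attacks x),
        x.1 + x.2 = c.1 + c.2 ∧ x ≠ c ∧ c ≠ a ∧ c ≠ b := fun hp => by
      obtain ⟨c, hc, e⟩ := mem_image.1 hp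
      have hcb := mem_board.1 (h.subset_board hc)
      have e' : x.1 + x.2 = c.1 + c.2 := by simp only [plusIdx] at e; omega
      have hxc : x ≠ c := fun e => hq (e ▸ hc)
      exact ⟨c, mem_filter.2 ⟨hc, Or.inr (Or.inr (Or.inl e'))⟩, e', hxc,
        fun e => eq_of_attacks_twice (x := x) (a := a) (Or.inl rfl) hxa (Or.inl (e ▸ e')),
        fun e => eq_of_attacks_twice (x := x) (a := b) (Or.inr rfl) hxb (Or.inl (e ▸ e'))⟩
    have hminus : minusIdx n x ∈ q.image (minusIdx n) → ∃ d ∈ q.filter (Attacks x),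
        x.2 + d.1 = d.2 + x.1 ∧ x ≠ d ∧ d ≠ a ∧ d ≠ b := fun hp => by
      obtain ⟨c, hc, e⟩ := mem_image.1 hp
      have hcb := mem_board.1 (h.subset_board hc)
      have e' : x.2 + c.1 = c.2 + x.1 := by simp only [minusIdx] at e; omega
      have hxc : x ≠ c := fun e => hq (e ▸ hc)
      exact ⟨c, mem_filter.2 ⟨hc, Or.inr (Or.inr (Or.inr e'))⟩, e', hxc,
        fun e => eq_of_attacks_twice (x := x) (a := a) (Or.inl rfl) hxa (Or.inr (e ▸ e')),
        fun e => eq_of_attacks_twice (x := x) (a := b) (Or.inr rfl) hxb (Or.inr (e ▸ e'))⟩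
  · obtain ⟨c, hcF, ec, hxc, hca, hcb⟩ := hplus hp
    obtain ⟨d, hdF, ed, hxd, hda, hdb⟩ := hminus hm
    have hcd : c ≠ d := fun e => hxc (by subst e; ext <;> omega)
    have : #({a, b, c, d} : Finset (ℕ × ℕ)) ≤ #(q.filter (Attacks x)) :=
      card_le_card (by simp [insert_subset_iff, haF, hbF, hcF, hdF])
    have h4 : #({a, b, c, d} : Finset (ℕ × ℕ)) = 4 := by
      rw [card_insert_of_notMem (by simp [hab, hca.symm, hda.symm]),
        card_insert_of_notMem (by simp [hcb.symm, hdb.symm]), card_pair hcd]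
    refine (pow_le_pow_of_le_one h0 h1 (h4 ▸ this)).trans (le_of_eq (by ring))
  · obtain ⟨c, hcF, ec, hxc, hca, hcb⟩ := hplus hp
    have : #({a, b, c} : Finset (ℕ × ℕ)) ≤ #(q.filter (Attacks x)) :=
      card_le_card (by simp [insert_subset_iff, haF, hbF, hcF])
    have h4 : #({a, b, c} : Finset (ℕ × ℕ)) = 3 := by
      rw [card_insert_of_notMem (by simp [hab, hca.symm]), card_pair hcb.symm]
    refine (pow_le_pow_of_le_one h0 h1 (h4 ▸ this)).trans (le_of_eq (by ring))
  · obtain ⟨d, hdF, ed, hxd, hda, hdb⟩ := hminus hm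
    have : #({a, b, d} : Finset (ℕ × ℕ)) ≤ #(q.filter (Attacks x)) :=
      card_le_card (by simp [insert_subset_iff, haF, hbF, hdF])
    have h4 : #({a, b, d} : Finset (ℕ × ℕ)) = 3 := by
      rw [card_insert_of_notMem (by simp [hab, hda.symm]), card_pair hdb.symm]
    refine (pow_le_pow_of_le_one h0 h1 (h4 ▸ this)).trans (le_of_eq (by ring))
  · have : #({a, b} : Finset (ℕ × ℕ)) ≤ #(q.filter (Attacks x)) :=
      card_le_card (by simp [insert_subset_iff, haF, hbF])
    refine (pow_le_pow_of_le_one h0 h1 (card_pair hab ▸ this)).trans (le_of_eq (by ring))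

/-- The squares of the board not attacked by `A`. -/
def availSquares (n : ℕ) (A : Finset (ℕ × ℕ)) : Finset (ℕ × ℕ) :=
  (board n).filter fun x => ∀ a ∈ A, ¬ Attacks x a

theorem sum_avail_le {n k : ℕ} (hk : k < n) {q : Finset (ℕ × ℕ)} (h : IsQueensConfig n q)
    (w : ℕ × ℕ → ℝ) (hw : ∀ x, 0 ≤ w x) :
    ∑ A ∈ q.powersetCard k, ∑ x ∈ availSquares n A, w x ≤
      n.choose k * ∑ x ∈ board n, w x * availBound n q (k / n) x := by
  have hn : (0 : ℝ) < n := by exact_mod_cast (by omega : 0 < n)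
  have h1 : ∑ A ∈ q.powersetCard k, ∑ x ∈ availSquares n A, w x =
      ∑ x ∈ board n, ∑ A ∈ (q.filter fun a => ¬ Attacks x a).powersetCard k, w x := by
    apply Finset.sum_comm'
    intro A x
    simp only [mem_powersetCard, availSquares, mem_filter, subset_iff]
    constructor
    · rintro ⟨⟨h1, h2⟩, h3, h4⟩
      exact ⟨⟨fun a ha => ⟨h1 ha, h4 a ha⟩, h2⟩, h3⟩
    · rintro ⟨⟨h1, h2⟩, h3⟩
      exact ⟨⟨fun a ha => (h1 ha).1, h2⟩, h3, fun a ha => (h1 ha).2⟩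
  rw [h1, Finset.mul_sum]
  refine Finset.sum_le_sum fun x hx => ?_
  rw [sum_const, card_powersetCard, nsmul_eq_mul]
  have hc : #(q.filter fun a => ¬ Attacks x a) = n - #(q.filter (Attacks x)) := by
    have := card_filter_add_card_filter_not (s := q) (Attacks x)
    rw [h.card] at this
    omega
  rw [hc]
  have hle : #(q.filter (Attacks x)) ≤ n := (card_filter_le _ _).trans h.card.le
  have ht : (k : ℝ) / n ≤ 1 := by rw [div_le_one hn]; exact_mod_cast hk.le
  calc _ ≤ n.choose k * (1 - (k : ℝ) / n) ^ #(q.filter (Attacks x)) * w x := by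
        gcongr; exacts [hw x, choose_sub_le hk _ hle]
    _ ≤ n.choose k * availBound n q (k / n) x * w x := by
        gcongr; exacts [hw x, pow_card_attackers_le h hx (by positivity) ht]
    _ = _ := by ring

theorem plusIdx_injOn {n : ℕ} {q : Finset (ℕ × ℕ)} (h : IsQueensConfig n q) :
    Set.InjOn plusIdx (q : Set (ℕ × ℕ)) := fun a ha b hb e => by
  have h1 := mem_board.1 (h.subset_board ha)
  have h2 := mem_board.1 (h.subset_board hb)
  simp only [plusIdx] at e
  exact h.eq_of_attacks ha hb (Or.inr (Or.inr (Or.inl (by omega))))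

theorem minusIdx_injOn {n : ℕ} {q : Finset (ℕ × ℕ)} (h : IsQueensConfig n q) :
    Set.InjOn (minusIdx n) (q : Set (ℕ × ℕ)) := fun a ha b hb e => by
  have h1 := mem_board.1 (h.subset_board ha)
  have h2 := mem_board.1 (h.subset_board hb)
  simp only [minusIdx] at e
  exact h.eq_of_attacks ha hb (Or.inr (Or.inr (Or.inr (by omega))))

theorem plusIdx_lt {n : ℕ} {x : ℕ × ℕ} (h : x ∈ board n) : plusIdx x < 2 * n := by
  rw [mem_board] at h; simp only [plusIdx]; omega

theorem minusIdx_lt {n : ℕ} {x : ℕ × ℕ} (h : x ∈ board n) : minusIdx n x < 2 * n := by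
  rw [mem_board] at h; simp only [minusIdx]; omega

theorem sum_one_sub_ite {κ : Type*} [DecidableEq κ] {n : ℕ} {q : Finset (ℕ × ℕ)}
    {idx : ℕ × ℕ → ℕ} (hinj : Set.InjOn idx (q : Set (ℕ × ℕ))) (hlt : ∀ x ∈ q, idx x < 2 * n)
    (b : ℕ → κ) (P : κ) (t : ℝ) :
    ∑ w ∈ range (2 * n) with b w = P, (1 - if w ∈ q.image idx then t else 0) =
      #{w ∈ range (2 * n) | b w = P} - t * #{x ∈ q | b (idx x) = P} := by
  rw [Finset.sum_sub_distrib, sum_const, nsmul_eq_mul, mul_one, ← Finset.sum_filter, sum_const,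
    nsmul_eq_mul, mul_comm t]
  congr 3
  have : #((q.filter fun x => b (idx x) = P).image idx) = #{x ∈ q | b (idx x) = P} :=
    card_image_of_injOn (hinj.mono (coe_subset.2 (filter_subset _ _)))
  rw [← this]
  congr 1
  ext w
  simp only [mem_filter, mem_range, mem_image]
  constructor
  · rintro ⟨⟨_, h2⟩, x, hx, rfl⟩; exact ⟨x, ⟨hx, h2⟩, rfl⟩
  · rintro ⟨x, ⟨hx, h2⟩, rfl⟩; exact ⟨⟨hlt x hx, h2⟩, x, hx, rfl⟩

/-- The pair of blocks containing the two diagonals through a square. -/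
def blockPair {κ : Type*} (n : ℕ) (b₁ b₂ : ℕ → κ) (x : ℕ × ℕ) : κ × κ :=
  (b₁ (plusIdx x), b₂ (minusIdx n x))

theorem sum_availBound_le {κ : Type*} [DecidableEq κ] {n : ℕ} {q : Finset (ℕ × ℕ)}
    (h : IsQueensConfig n q) (b₁ b₂ : ℕ → κ) (a : κ × κ) {t : ℝ} (ht : t ≤ 1) :
    ∑ x ∈ board n with blockPair n b₁ b₂ x = a, availBound n q t x ≤
      (1 - t) ^ 2 * ((#{w ∈ range (2 * n) | b₁ w = a.1} - t * #{x ∈ q | b₁ (plusIdx x) = a.1}) *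
        (#{w ∈ range (2 * n) | b₂ w = a.2} - t * #{x ∈ q | b₂ (minusIdx n x) = a.2})) +
      (1 - t) * #{x ∈ q | blockPair n b₁ b₂ x = a} := by
  have h0 : 0 ≤ 1 - t := by linarith
  set u : ℕ → ℝ := fun w => 1 - if w ∈ q.image plusIdx then t else 0 with hu
  set v : ℕ → ℝ := fun w => 1 - if w ∈ q.image (minusIdx n) then t else 0 with hv
  have u0 : ∀ w, 0 ≤ u w := fun w => by simp only [hu]; split_ifs <;> linarith
  have v0 : ∀ w, 0 ≤ v w := fun w => by simp only [hv]; split_ifs <;> linarith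
  rw [← sum_one_sub_ite (plusIdx_injOn h) (fun x hx => plusIdx_lt (h.subset_board hx)),
    ← sum_one_sub_ite (minusIdx_injOn h) (fun x hx => minusIdx_lt (h.subset_board hx))]
  have h1 : ∀ x ∈ (board n).filter (fun x => blockPair n b₁ b₂ x = a), availBound n q t x ≤
      (1 - t) ^ 2 * (u (plusIdx x) * v (minusIdx n x)) + if x ∈ q then (1 - t) else 0 := by
    intro x _
    have := mul_nonneg (pow_nonneg h0 2) (mul_nonneg (u0 (plusIdx x)) (v0 (minusIdx n x)))
    unfold availBound
    by_cases hx : x ∈ q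
    · simp only [hx, if_true]; linarith
    · simp [hx, hu, hv]
  refine (Finset.sum_le_sum h1).trans ?_
  rw [Finset.sum_add_distrib, ← Finset.mul_sum]
  have h2 : ∑ x ∈ board n with blockPair n b₁ b₂ x = a, (if x ∈ q then (1 - t) else 0) =
      (1 - t) * #{x ∈ q | blockPair n b₁ b₂ x = a} := by
    rw [← Finset.sum_filter, sum_const, nsmul_eq_mul, mul_comm]
    congr 3
    ext x
    simp only [mem_filter]
    exact ⟨fun h => ⟨h.2, h.1.2⟩, fun hx => ⟨⟨h.subset_board hx.1, hx.2⟩, hx.1⟩⟩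
  rw [h2]
  gcongr
  rw [Finset.sum_mul_sum, ← Finset.sum_product']
  have inj : Set.InjOn (fun x => (plusIdx x, minusIdx n x))
      ((board n).filter (fun x => blockPair n b₁ b₂ x = a) : Set (ℕ × ℕ)) := by
    intro x hx y hy e
    have hx' := mem_board.1 (mem_filter.1 (mem_coe.1 hx)).1
    have hy' := mem_board.1 (mem_filter.1 (mem_coe.1 hy)).1
    simp only [plusIdx, minusIdx, Prod.mk.injEq] at e
    ext <;> omega
  rw [← Finset.sum_image (f := fun w : ℕ × ℕ => u w.1 * v w.2) inj]
  refine Finset.sum_le_sum_of_subset_of_nonneg ?_ fun w _ _ => mul_nonneg (u0 _) (v0 _)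
  intro w hw
  obtain ⟨x, hx, rfl⟩ := mem_image.1 hw
  obtain ⟨hxb, e⟩ := mem_filter.1 hx
  subst e
  exact mem_product.2 ⟨mem_filter.2 ⟨mem_range.2 (plusIdx_lt hxb), rfl⟩,
    mem_filter.2 ⟨mem_range.2 (minusIdx_lt hxb), rfl⟩⟩

/-- The number of queens of `q` in each pair of blocks. -/
def blockCount {κ : Type*} [DecidableEq κ] (n : ℕ) (b₁ b₂ : ℕ → κ) (q : Finset (ℕ × ℕ))
    (a : κ × κ) : ℕ := #{x ∈ q | blockPair n b₁ b₂ x = a}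

theorem sum_blockCount_fst {κ : Type*} [DecidableEq κ] [Fintype κ] (n : ℕ) (b₁ b₂ : ℕ → κ)
    (q : Finset (ℕ × ℕ)) (P : κ) :
    #{x ∈ q | b₁ (plusIdx x) = P} = ∑ Q, blockCount n b₁ b₂ q (P, Q) := by
  rw [card_eq_sum_card_fiberwise (f := fun x => b₂ (minusIdx n x)) (t := univ) (by simp)]
  refine Finset.sum_congr rfl fun Q _ => ?_
  simp only [blockCount, blockPair, filter_filter, Prod.mk.injEq]

theorem sum_blockCount_snd {κ : Type*} [DecidableEq κ] [Fintype κ] (n : ℕ) (b₁ b₂ : ℕ → κ)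
    (q : Finset (ℕ × ℕ)) (Q : κ) :
    #{x ∈ q | b₂ (minusIdx n x) = Q} = ∑ P, blockCount n b₁ b₂ q (P, Q) := by
  rw [card_eq_sum_card_fiberwise (f := fun x => b₁ (plusIdx x)) (t := univ) (by simp)]
  refine Finset.sum_congr rfl fun P _ => ?_
  simp only [blockCount, blockPair, filter_filter, Prod.mk.injEq, and_comm]

theorem sum_blockCount {κ : Type*} [DecidableEq κ] [Fintype κ] (n : ℕ) (b₁ b₂ : ℕ → κ)
    (q : Finset (ℕ × ℕ)) : ∑ a, blockCount n b₁ b₂ q a = #q :=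
  (card_eq_sum_card_fiberwise (f := blockPair n b₁ b₂) (t := univ) (by simp)).symm

theorem card_block_le {κ : Type*} [DecidableEq κ] {n : ℕ} {q : Finset (ℕ × ℕ)}
    {idx : ℕ × ℕ → ℕ} (hinj : Set.InjOn idx (q : Set (ℕ × ℕ))) (hlt : ∀ x ∈ q, idx x < 2 * n)
    (b : ℕ → κ) (P : κ) : #{x ∈ q | b (idx x) = P} ≤ #{w ∈ range (2 * n) | b w = P} := by
  refine card_le_card_of_injOn idx (fun x hx => ?_)
    (hinj.mono (coe_subset.2 (filter_subset _ _)))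
  rw [mem_coe, mem_filter] at hx
  simp [hlt x hx.1, hx.2]

/-- Upper bound for the expected number of available squares in a pair of blocks. -/
noncomputable def availMass {κ : Type*} [Fintype κ] (n c : ℕ) (L : ℝ) (m : κ × κ → ℕ) (k : ℕ)
    (a : κ × κ) : ℝ :=
  (1 - (k : ℝ) / n) * (1 - (k : ℝ) / n + c / n) *
    ((L - (k : ℝ) / n * ∑ Q, (m (a.1, Q) : ℝ)) * (L - (k : ℝ) / n * ∑ P, (m (P, a.2) : ℝ)))

theorem card_queens_of_type_le {κ : Type*} [DecidableEq κ] [Fintype κ] {n c : ℕ} (hn : 0 < n)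
    (b₁ b₂ : ℕ → κ) {L δ : ℝ} (hL : 0 < L) (hδ : 0 < δ)
    (hL₁ : ∀ P, (#{w ∈ range (2 * n) | b₁ w = P} : ℝ) ≤ L)
    (hL₂ : ∀ P, (#{w ∈ range (2 * n) | b₂ w = P} : ℝ) ≤ L) (hc : n ≤ c * (δ ^ 2 * L))
    (m : κ × κ → ℕ) (F : Finset (Finset (ℕ × ℕ)))
    (hF : ∀ q ∈ F, IsQueensConfig n q ∧ blockCount n b₁ b₂ q = m) :
    (#F : ℝ) * Real.exp (Real.log n.factorial - n * Real.log n +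
      (∑ k ∈ range n, ∑ a, (m a : ℝ) *
        (Real.log (m a) - Real.log (availMass n c ((1 + δ) * L) m k a))) / n) ≤ 1 := by
  rcases F.eq_empty_or_nonempty with rfl | ⟨q₀, hq₀⟩
  · simp
  have hn' : (0 : ℝ) < n := by exact_mod_cast hn
  have sum_fst : ∀ q ∈ F, ∀ P, (#{x ∈ q | b₁ (plusIdx x) = P} : ℝ) = ∑ Q, (m (P, Q) : ℝ) :=
    fun q hq P => by rw [sum_blockCount_fst n b₁ b₂, (hF q hq).2]; push_cast; rfl
  have sum_snd : ∀ q ∈ F, ∀ Q, (#{x ∈ q | b₂ (minusIdx n x) = Q} : ℝ) = ∑ P, (m (P, Q) : ℝ) :=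
    fun q hq Q => by rw [sum_blockCount_snd n b₁ b₂, (hF q hq).2]; push_cast; rfl
  have le_fst : ∀ P, ∑ Q, (m (P, Q) : ℝ) ≤ L := fun P => by
    rw [← sum_fst q₀ hq₀]
    refine le_trans ?_ (hL₁ P)
    exact_mod_cast card_block_le (plusIdx_injOn (hF _ hq₀).1)
      (fun x hx => plusIdx_lt ((hF _ hq₀).1.subset_board hx)) b₁ P
  have le_snd : ∀ Q, ∑ P, (m (P, Q) : ℝ) ≤ L := fun Q => by
    rw [← sum_snd q₀ hq₀]
    refine le_trans ?_ (hL₂ Q)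
    exact_mod_cast card_block_le (minusIdx_injOn (hF _ hq₀).1)
      (fun x hx => minusIdx_lt ((hF _ hq₀).1.subset_board hx)) b₂ Q
  have t_lt : ∀ k < n, (k : ℝ) / n < 1 := fun k hk => by
    rw [div_lt_one hn']; exact_mod_cast hk
  have gap : ∀ (t o : ℝ), 0 ≤ t → t < 1 → 0 ≤ o → o ≤ L →
      0 ≤ L - t * o ∧ 0 < (1 + δ) * L - t * o := by
    intro t o ht0 ht ho hoL
    have h1 : t * o ≤ o := mul_le_of_le_one_left ho ht.le
    have h2 := mul_pos hδ hL
    constructor <;> nlinarith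
  have M_pos : ∀ k < n, ∀ a, 0 < availMass n c ((1 + δ) * L) m k a := by
    intro k hk a
    have ht := t_lt k hk
    have ht0 : 0 ≤ (k : ℝ) / n := by positivity
    unfold availMass
    have h1 := (gap _ _ ht0 ht (Finset.sum_nonneg fun _ _ => Nat.cast_nonneg _) (le_fst a.1)).2
    have h2 := (gap _ _ ht0 ht (Finset.sum_nonneg fun _ _ => Nat.cast_nonneg _) (le_snd a.2)).2
    have h3 : 0 < 1 - (k : ℝ) / n := by linarith
    have h4 : 0 < 1 - (k : ℝ) / n + c / n := by positivity
    positivity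
  set w : ℕ → ℕ × ℕ → ℝ := fun k x => if k < n then (m (blockPair n b₁ b₂ x) : ℝ) /
    availMass n c ((1 + δ) * L) m k (blockPair n b₁ b₂ x) else 1 with hw
  have m_pos : ∀ q ∈ F, ∀ x ∈ q, 0 < m (blockPair n b₁ b₂ x) := fun q hq x hx => by
    rw [← (hF q hq).2]
    exact card_pos.2 ⟨x, by simp [hx]⟩
  have w_nn : ∀ k x, 0 ≤ w k x := fun k x => by
    simp only [hw]; split_ifs with h
    exacts [div_nonneg (Nat.cast_nonneg _) (M_pos k h _).le, zero_le_one]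
  refine card_mul_exp_le_one hn (board n) F
    (fun q hq => ⟨(hF q hq).1.subset_board, (hF q hq).1.card⟩) (availSquares n)
    (fun A => filter_subset _ _) ?_ w w_nn ?_ ?_ _ ?_
  · intro q hq A hA x hx
    rw [Finset.mem_sdiff] at hx
    refine mem_filter.2 ⟨(hF q hq).1.subset_board hx.1, fun a ha hxa => hx.2 ?_⟩
    rwa [(hF q hq).1.eq_of_attacks hx.1 (hA ha) hxa]
  · intro k q hq x hx
    simp only [hw]; split_ifs with h
    exacts [div_pos (Nat.cast_pos.2 (m_pos q hq x hx)) (M_pos k h _), zero_lt_one]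
  · intro q hq k hk
    have hQ := (hF q hq).1
    refine (sum_avail_le hk hQ (w k) (w_nn k)).trans ?_
    gcongr
    have ht := t_lt k hk
    have ht0 : 0 ≤ (k : ℝ) / n := by positivity
    rw [← Finset.sum_fiberwise (board n) (blockPair n b₁ b₂)]
    have : ∀ a : κ × κ, ∑ x ∈ board n with blockPair n b₁ b₂ x = a,
        w k x * availBound n q (k / n) x ≤ m a := by
      intro a
      have e1 : ∑ x ∈ board n with blockPair n b₁ b₂ x = a, w k x * availBound n q (k / n) x =
          (m a : ℝ) / availMass n c ((1 + δ) * L) m k a *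
          ∑ x ∈ board n with blockPair n b₁ b₂ x = a, availBound n q (k / n) x := by
        rw [Finset.mul_sum]
        refine Finset.sum_congr rfl fun x hx => ?_
        simp only [hw, if_pos hk, (mem_filter.1 hx).2]
      rw [e1, div_mul_eq_mul_div, div_le_iff₀ (M_pos k hk a)]
      gcongr
      refine (sum_availBound_le hQ b₁ b₂ a ht.le).trans ?_
      rw [sum_fst q hq, sum_snd q hq]
      have hma : (#{x ∈ q | blockPair n b₁ b₂ x = a} : ℝ) = m a := by
        rw [← (hF q hq).2]; rfl
      rw [hma]
      have hmL : (m a : ℝ) ≤ L :=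
        (Finset.single_le_sum (f := fun Q => (m (a.1, Q) : ℝ)) (fun _ _ => Nat.cast_nonneg _)
          (mem_univ a.2)).trans (le_fst a.1)
      unfold availMass
      set t := (k : ℝ) / n
      set o₁ := ∑ Q, (m (a.1, Q) : ℝ)
      set o₂ := ∑ P, (m (P, a.2) : ℝ)
      have ho₁ : 0 ≤ o₁ := Finset.sum_nonneg fun _ _ => Nat.cast_nonneg _
      have ho₂ : 0 ≤ o₂ := Finset.sum_nonneg fun _ _ => Nat.cast_nonneg _
      have g₁ := gap t o₁ ht0 ht ho₁ (le_fst _)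
      have g₂ := gap t o₂ ht0 ht ho₂ (le_snd _)
      have l₁ := hL₁ a.1
      have l₂ := hL₂ a.2
      have h1t : 0 < 1 - t := by linarith
      have hcn : 0 ≤ (c : ℝ) / n := by positivity
      have hprod : (#{w ∈ range (2 * n) | b₁ w = a.1} - t * o₁) *
          (#{w ∈ range (2 * n) | b₂ w = a.2} - t * o₂) ≤ (L - t * o₁) * (L - t * o₂) := by
        refine mul_le_mul (by linarith) (by linarith) ?_ g₁.1
        have : o₂ ≤ #{w ∈ range (2 * n) | b₂ w = a.2} := by
          simp only [o₂]
          rw [← sum_snd q hq]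
          exact_mod_cast card_block_le (minusIdx_injOn hQ)
            (fun x hx => minusIdx_lt (hQ.subset_board hx)) b₂ a.2
        have : t * o₂ ≤ o₂ := mul_le_of_le_one_left ho₂ ht.le
        linarith
      have hprod2 : (L - t * o₁) * (L - t * o₂) + (δ * L) ^ 2 ≤
          ((1 + δ) * L - t * o₁) * ((1 + δ) * L - t * o₂) := by
        have := mul_pos hδ hL
        nlinarith [g₁.1, g₂.1]
      have hcL : L ≤ c / n * (δ * L) ^ 2 := by
        have : n * L ≤ c * (δ ^ 2 * L) * L := by gcongr
        calc L = n * L / n := by field_simp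
          _ ≤ c * (δ ^ 2 * L) * L / n := by gcongr
          _ = _ := by ring
      have hpp : (δ * L) ^ 2 ≤ ((1 + δ) * L - t * o₁) * ((1 + δ) * L - t * o₂) := by
        have := mul_nonneg g₁.1 g₂.1
        linarith
      calc (1 - t) ^ 2 * ((#{w ∈ range (2 * n) | b₁ w = a.1} - t * o₁) *
          (#{w ∈ range (2 * n) | b₂ w = a.2} - t * o₂)) + (1 - t) * m a
          ≤ (1 - t) ^ 2 * (((1 + δ) * L - t * o₁) * ((1 + δ) * L - t * o₂)) +
            (1 - t) * (c / n * (((1 + δ) * L - t * o₁) * ((1 + δ) * L - t * o₂))) := by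
            refine add_le_add (mul_le_mul_of_nonneg_left ?_ (by positivity))
              (mul_le_mul_of_nonneg_left ?_ h1t.le)
            · linarith [sq_nonneg (δ * L)]
            · exact hmL.trans (hcL.trans (mul_le_mul_of_nonneg_left hpp hcn))
        _ = _ := by ring
    refine (Finset.sum_le_sum fun a _ => this a).trans (le_of_eq ?_)
    have := sum_blockCount n b₁ b₂ q
    rw [(hF q hq).2, hQ.card] at this
    exact_mod_cast this
  · intro q hq
    rw [mul_div_cancel₀ _ hn'.ne']
    refine Finset.sum_le_sum fun k hk => ?_
    rw [mem_range] at hk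
    rw [← Finset.sum_fiberwise q (blockPair n b₁ b₂)]
    refine le_of_eq (Finset.sum_congr rfl fun a _ => ?_)
    have : ∀ x ∈ q.filter (fun x => blockPair n b₁ b₂ x = a), Real.log (w k x) =
        Real.log (m a) - Real.log (availMass n c ((1 + δ) * L) m k a) := by
      intro x hx
      obtain ⟨hxq, rfl⟩ := mem_filter.1 hx
      simp only [hw, if_pos hk]
      rw [Real.log_div (by exact_mod_cast (m_pos q hq x hxq).ne') (M_pos k hk _).ne']
    rw [Finset.sum_congr rfl this, sum_const, nsmul_eq_mul]
    congr 2
    rw [← (hF q hq).2]; rfl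

theorem mul_log_add_le {y h : ℝ} (hy : 0 < y) (hh : 0 ≤ h) :
    h * Real.log (y + h) ≤ Real.negMulLog y - Real.negMulLog (y + h) - h + h ^ 2 / y := by
  have h1 : Real.log (y + h) - Real.log y ≥ 1 - y / (y + h) := by
    have := Real.one_sub_inv_le_log_of_pos (x := (y + h) / y) (by positivity)
    rw [inv_div, Real.log_div (by positivity) (by positivity)] at this
    exact this
  have h2 : h - h ^ 2 / y ≤ y * (1 - y / (y + h)) := by
    have e : y * (1 - y / (y + h)) - (h - h ^ 2 / y) = h ^ 3 / (y * (y + h)) := by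
      field_simp; ring
    have : 0 ≤ h ^ 3 / (y * (y + h)) := by positivity
    linarith
  have h3 := mul_le_mul_of_nonneg_left h1 hy.le
  simp only [Real.negMulLog]
  nlinarith

theorem sum_log_sub_le {n : ℕ} (hn : 0 < n) {L δ o : ℝ} (hL : 0 < L) (hδ : 0 < δ) (ho : 0 ≤ o)
    (hoL : o ≤ L) :
    o / n * ∑ k ∈ range n, Real.log ((1 + δ) * L - k / n * o) ≤
      Real.negMulLog ((1 + δ) * L - o) - Real.negMulLog ((1 + δ) * L) - o + o / n / δ := by
  have hn' : (0 : ℝ) < n := by exact_mod_cast hn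
  set h := o / n with hh
  have h0 : 0 ≤ h := by positivity
  have hnh : n * h = o := by rw [hh]; field_simp
  have key : ∀ k ∈ range n, h * Real.log ((1 + δ) * L - k / n * o) ≤
      (Real.negMulLog ((1 + δ) * L - ((k + 1 : ℕ) : ℝ) * h) -
        Real.negMulLog ((1 + δ) * L - k * h)) - h + h ^ 2 / (δ * L) := by
    intro k hk
    have hk' : ((k + 1 : ℕ) : ℝ) ≤ n := by exact_mod_cast mem_range.1 hk
    have hkh : ((k + 1 : ℕ) : ℝ) * h ≤ o := hnh ▸ mul_le_mul_of_nonneg_right hk' h0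
    have hy : δ * L ≤ (1 + δ) * L - ((k + 1 : ℕ) : ℝ) * h := by linarith
    have hpos : 0 < δ * L := by positivity
    have := mul_log_add_le (hpos.trans_le hy) h0
    have e1 : (1 + δ) * L - ((k + 1 : ℕ) : ℝ) * h + h = (1 + δ) * L - k * h := by
      push_cast; ring
    have e2 : (1 + δ) * L - k / n * o = (1 + δ) * L - k * h := by rw [hh]; ring
    rw [e1] at this
    rw [e2]
    refine this.trans ?_
    gcongr
  rw [mul_sum]
  refine (sum_le_sum key).trans ?_
  rw [sum_add_distrib, sum_sub_distrib,
    sum_range_sub (fun k : ℕ => Real.negMulLog ((1 + δ) * L - (k : ℝ) * h))]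
  simp only [sum_const, card_range, nsmul_eq_mul, Nat.cast_zero, zero_mul, sub_zero, hnh]
  have : n * (h ^ 2 / (δ * L)) ≤ h / δ := by
    have e : n * (h ^ 2 / (δ * L)) = (h / δ) * (o / L) := by
      rw [← hnh]; field_simp
    rw [e]
    exact mul_le_of_le_one_right (by positivity) ((div_le_one hL).2 hoL)
  linarith

theorem sum_log_eq_log_factorial (n : ℕ) :
    ∑ k ∈ range n, Real.log ((n : ℝ) - k) = Real.log n.factorial := by
  have h1 : ∀ k ∈ range n, Real.log ((n : ℝ) - k) = Real.log ((n - 1 - k : ℕ) + 1 : ℝ) := by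
    intro k hk
    have := mem_range.1 hk
    congr 1
    rw [← Nat.cast_add_one, show n - 1 - k + 1 = n - k by omega, Nat.cast_sub this.le]
  rw [sum_congr rfl h1, sum_range_reflect (fun k => Real.log ((k : ℝ) + 1))]
  induction n with
  | zero => simp
  | succ n ih =>
    have : ∀ k ∈ range n, Real.log ((n : ℝ) - k) = Real.log ((n - 1 - k : ℕ) + 1 : ℝ) := by
      intro k hk
      have := mem_range.1 hk
      congr 1
      rw [← Nat.cast_add_one, show n - 1 - k + 1 = n - k by omega, Nat.cast_sub this.le]
    rw [sum_range_succ, ih this, Nat.factorial_succ, Nat.cast_mul, Real.log_mul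
      (by positivity) (by positivity)]
    push_cast; ring

theorem sum_log_one_sub (n : ℕ) :
    ∑ k ∈ range n, Real.log (1 - (k : ℝ) / n) = Real.log n.factorial - n * Real.log n := by
  rw [← sum_log_eq_log_factorial]
  have : ∀ k ∈ range n, Real.log (1 - (k : ℝ) / n) = Real.log ((n : ℝ) - k) - Real.log n := by
    intro k hk
    have hk := mem_range.1 hk
    have hn : (0 : ℝ) < n := by exact_mod_cast (Nat.zero_le k).trans_lt hk
    have hk' : (k : ℝ) < n := by exact_mod_cast hk
    rw [← Real.log_div (by linarith) hn.ne']
    congr 1; field_simp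
  rw [sum_congr rfl this, sum_sub_distrib]
  simp

theorem sum_inv_sub_le (n : ℕ) :
    ∑ k ∈ range n, ((n : ℝ) - k)⁻¹ ≤ 1 + Real.log n := by
  have h := harmonic_le_one_add_log n
  refine le_trans (le_of_eq ?_) h
  rw [harmonic, ← sum_range_reflect]
  push_cast
  refine sum_congr rfl fun k hk => ?_
  have := mem_range.1 hk
  rw [← Nat.cast_sub (by omega), show n - (n - 1 - k) = k + 1 by omega, Nat.cast_add_one]

theorem sum_log_one_sub_add_le (n c : ℕ) (hn : 0 < n) :
    ∑ k ∈ range n, Real.log (1 - (k : ℝ) / n + c / n) ≤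
      Real.log n.factorial - n * Real.log n + c * (1 + Real.log n) := by
  rw [← sum_log_one_sub]
  have hn' : (0 : ℝ) < n := by exact_mod_cast hn
  have : ∀ k ∈ range n, Real.log (1 - (k : ℝ) / n + c / n) ≤
      Real.log (1 - (k : ℝ) / n) + c * ((n : ℝ) - k)⁻¹ := by
    intro k hk
    have hk' : (k : ℝ) < n := by exact_mod_cast mem_range.1 hk
    have h1 : 0 < (n : ℝ) - k := by linarith
    have e : 1 - (k : ℝ) / n + c / n = (1 - (k : ℝ) / n) * (1 + c * ((n : ℝ) - k)⁻¹) := by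
      field_simp
    have e' : 0 < 1 - (k : ℝ) / n := by rw [sub_pos, div_lt_one hn']; exact hk'
    rw [e, Real.log_mul e'.ne' (by positivity)]
    have := Real.log_le_sub_one_of_pos (x := 1 + c * ((n : ℝ) - k)⁻¹) (by positivity)
    linarith
  refine (sum_le_sum this).trans ?_
  rw [sum_add_distrib, ← mul_sum]
  have := mul_le_mul_of_nonneg_left (sum_inv_sub_le n) (Nat.cast_nonneg (α := ℝ) c)
  linarith

theorem log_factorial_le (n : ℕ) :
    Real.log n.factorial ≤ (n + 1) * Real.log (n + 1) - n := by
  induction n with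
  | zero => simp
  | succ n ih =>
    rw [Nat.factorial_succ, Nat.cast_mul, Real.log_mul (by positivity) (by positivity)]
    push_cast
    have h := Real.one_sub_inv_le_log_of_pos (x := ((n : ℝ) + 2) / (n + 1)) (by positivity)
    rw [inv_div, Real.log_div (by positivity) (by positivity)] at h
    have h' := mul_le_mul_of_nonneg_left h (by positivity : (0 : ℝ) ≤ n + 2)
    have e : ((n : ℝ) + 2) * (1 - (n + 1) / (n + 2)) = 1 := by field_simp; ring
    have : (n : ℝ) + 1 + 1 = n + 2 := by ring
    rw [this]
    linarith

theorem log_factorial_sub_le (n : ℕ) (hn : 0 < n) :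
    Real.log n.factorial - n * Real.log n ≤ Real.log (n + 1) + 1 - n := by
  have hn' : (0 : ℝ) < n := by exact_mod_cast hn
  have h1 := log_factorial_le n
  have h2 := Real.log_le_sub_one_of_pos (x := ((n : ℝ) + 1) / n) (by positivity)
  rw [Real.log_div (by positivity) (by positivity)] at h2
  have h3 := mul_le_mul_of_nonneg_left h2 hn'.le
  have e : (n : ℝ) * ((n + 1) / n - 1) = 1 := by field_simp; ring
  linarith

theorem negMulLog_nat_mul (n : ℝ) (x : ℝ) :
    Real.negMulLog (n * x) = n * Real.negMulLog x - (n * x) * Real.log n := by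
  rw [Real.negMulLog_mul]; simp only [Real.negMulLog]; ring

/-- The entropy functional of a distribution `x` on pairs of blocks of relative length `ℓ`. -/
noncomputable def blockEntropy {κ : Type*} [Fintype κ] (ℓ : ℝ) (x : κ × κ → ℝ) : ℝ :=
  ∑ P, (Real.negMulLog (ℓ - ∑ Q, x (P, Q)) - Real.negMulLog ℓ) +
    ∑ Q, (Real.negMulLog (ℓ - ∑ P, x (P, Q)) - Real.negMulLog ℓ) + ∑ a, Real.negMulLog (x a)

theorem card_queens_of_type_le_exp {κ : Type*} [DecidableEq κ] [Fintype κ] {n c : ℕ} (hn : 0 < n)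
    (b₁ b₂ : ℕ → κ) {L δ : ℝ} (hL : 0 < L) (hδ : 0 < δ)
    (hL₁ : ∀ P, (#{w ∈ range (2 * n) | b₁ w = P} : ℝ) ≤ L)
    (hL₂ : ∀ P, (#{w ∈ range (2 * n) | b₂ w = P} : ℝ) ≤ L) (hc : n ≤ c * (δ ^ 2 * L))
    (m : κ × κ → ℕ) (F : Finset (Finset (ℕ × ℕ)))
    (hF : ∀ q ∈ F, IsQueensConfig n q ∧ blockCount n b₁ b₂ q = m) :
    (#F : ℝ) ≤ Real.exp (n * (Real.log n - 3 +
      blockEntropy ((1 + δ) * L / n) (fun a => (m a : ℝ) / n)) +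
      (Real.log (n + 1) + 1 + c * (1 + Real.log n) + 2 / δ)) := by
  rcases F.eq_empty_or_nonempty with rfl | ⟨q₀, hq₀⟩
  · simp; positivity
  have hn' : (0 : ℝ) < n := by exact_mod_cast hn
  have hmain := card_queens_of_type_le hn b₁ b₂ hL hδ hL₁ hL₂ hc m F hF
  obtain ⟨hq, hm⟩ := hF q₀ hq₀
  have le_fst : ∀ P, ∑ Q, (m (P, Q) : ℝ) ≤ L := fun P => by
    refine le_trans ?_ (hL₁ P)
    rw [← hm]
    exact_mod_cast (sum_blockCount_fst n b₁ b₂ q₀ P) ▸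
      card_block_le (plusIdx_injOn hq) (fun x hx => plusIdx_lt (hq.subset_board hx)) b₁ P
  have le_snd : ∀ Q, ∑ P, (m (P, Q) : ℝ) ≤ L := fun Q => by
    refine le_trans ?_ (hL₂ Q)
    rw [← hm]
    exact_mod_cast (sum_blockCount_snd n b₁ b₂ q₀ Q) ▸
      card_block_le (minusIdx_injOn hq) (fun x hx => minusIdx_lt (hq.subset_board hx)) b₂ Q
  have tot : ∑ a, (m a : ℝ) = n := by
    rw [← hm]
    exact_mod_cast (sum_blockCount n b₁ b₂ q₀).trans hq.card
  have tot₁ : ∑ P, ∑ Q, (m (P, Q) : ℝ) = n := by rw [← Fintype.sum_prod_type']; exact tot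
  have tot₂ : ∑ Q, ∑ P, (m (P, Q) : ℝ) = n := by rw [sum_comm]; exact tot₁
  set L' := (1 + δ) * L with hL'
  set o₁ : κ → ℝ := fun P => ∑ Q, (m (P, Q) : ℝ) with ho₁
  set o₂ : κ → ℝ := fun Q => ∑ P, (m (P, Q) : ℝ) with ho₂
  have o₁0 : ∀ P, 0 ≤ o₁ P := fun P => sum_nonneg fun _ _ => Nat.cast_nonneg _
  have o₂0 : ∀ P, 0 ≤ o₂ P := fun P => sum_nonneg fun _ _ => Nat.cast_nonneg _
  have posf : ∀ o : ℝ, 0 ≤ o → o ≤ L → ∀ k ∈ range n, 0 < L' - k / n * o := by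
    intro o h0 h1 k hk
    have hk' : (k : ℝ) / n ≤ 1 := (div_le_one hn').2 (by exact_mod_cast (mem_range.1 hk).le)
    have : (k : ℝ) / n * o ≤ o := mul_le_of_le_one_left h0 hk'
    have : 0 < δ * L := by positivity
    rw [hL']; linarith
  have logmass : ∀ k ∈ range n, ∀ a, Real.log (availMass n c L' m k a) =
      Real.log (1 - (k : ℝ) / n) + Real.log (1 - (k : ℝ) / n + c / n) +
        Real.log (L' - k / n * o₁ a.1) + Real.log (L' - k / n * o₂ a.2) := by
    intro k hk a
    have h1 : 0 < 1 - (k : ℝ) / n := by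
      rw [sub_pos, div_lt_one hn']; exact_mod_cast mem_range.1 hk
    have h2 : 0 < 1 - (k : ℝ) / n + c / n := by positivity
    have h3 := posf _ (o₁0 a.1) (le_fst a.1) k hk
    have h4 := posf _ (o₂0 a.2) (le_snd a.2) k hk
    rw [availMass, Real.log_mul (mul_pos h1 h2).ne' (mul_pos h3 h4).ne', Real.log_mul h1.ne' h2.ne',
      Real.log_mul h3.ne' h4.ne']
    ring
  have mass : (∑ k ∈ range n, ∑ a, (m a : ℝ) * Real.log (availMass n c L' m k a)) / n =
      ∑ k ∈ range n, Real.log (1 - (k : ℝ) / n) +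
        ∑ k ∈ range n, Real.log (1 - (k : ℝ) / n + c / n) +
      ∑ P, o₁ P / n * ∑ k ∈ range n, Real.log (L' - k / n * o₁ P) +
      ∑ Q, o₂ Q / n * ∑ k ∈ range n, Real.log (L' - k / n * o₂ Q) := by
    have step : ∀ k ∈ range n, ∑ a, (m a : ℝ) * Real.log (availMass n c L' m k a) =
        n * (Real.log (1 - (k : ℝ) / n) + Real.log (1 - (k : ℝ) / n + c / n)) +
        ∑ P, o₁ P * Real.log (L' - k / n * o₁ P) + ∑ Q, o₂ Q * Real.log (L' - k / n * o₂ Q) := by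
      intro k hk
      rw [sum_congr rfl fun a _ => by rw [logmass k hk a]]
      simp only [mul_add, sum_add_distrib, ← sum_mul, tot]
      have e1 : ∑ a : κ × κ, (m a : ℝ) * Real.log (L' - k / n * o₁ a.1) =
          ∑ P, o₁ P * Real.log (L' - k / n * o₁ P) := by
        rw [Fintype.sum_prod_type]
        exact sum_congr rfl fun P _ => by rw [ho₁, sum_mul]
      have e2 : ∑ a : κ × κ, (m a : ℝ) * Real.log (L' - k / n * o₂ a.2) =
          ∑ Q, o₂ Q * Real.log (L' - k / n * o₂ Q) := by
        rw [Fintype.sum_prod_type_right]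
        exact sum_congr rfl fun P _ => by rw [ho₂, sum_mul]
      rw [e1, e2]
    rw [sum_congr rfl step]
    simp only [sum_add_distrib, ← mul_sum]
    rw [sum_comm, sum_comm (s := range n) (t := univ) (f := fun k Q => o₂ Q * _), add_div, add_div,
      mul_div_cancel_left₀ _ hn'.ne', sum_div, sum_div]
    congr 1; congr 1
    all_goals refine sum_congr rfl fun P _ => ?_
    all_goals rw [← mul_sum]; ring
  have ent : (∑ k ∈ range n, ∑ a, (m a : ℝ) *
        (Real.log (m a) - Real.log (availMass n c L' m k a))) / n =
      -(∑ a, Real.negMulLog (m a)) -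
        (∑ k ∈ range n, ∑ a, (m a : ℝ) * Real.log (availMass n c L' m k a)) / n := by
    simp only [mul_sub, sum_sub_distrib, sum_const, card_range, nsmul_eq_mul, sub_div]
    rw [mul_div_cancel_left₀ _ hn'.ne', ← sum_neg_distrib]
    simp [Real.negMulLog]
  have b1 : ∑ P, o₁ P / n * ∑ k ∈ range n, Real.log (L' - k / n * o₁ P) ≤
      ∑ P, (Real.negMulLog (L' - o₁ P) - Real.negMulLog L') - n + 1 / δ := by
    refine (sum_le_sum fun P _ => sum_log_sub_le hn hL hδ (o₁0 P) (le_fst P)).trans (le_of_eq ?_)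
    rw [sum_add_distrib, sum_sub_distrib, ← sum_div, ← sum_div, tot₁, div_self hn'.ne']
  have b2 : ∑ P, o₂ P / n * ∑ k ∈ range n, Real.log (L' - k / n * o₂ P) ≤
      ∑ P, (Real.negMulLog (L' - o₂ P) - Real.negMulLog L') - n + 1 / δ := by
    refine (sum_le_sum fun P _ => sum_log_sub_le hn hL hδ (o₂0 P) (le_snd P)).trans (le_of_eq ?_)
    rw [sum_add_distrib, sum_sub_distrib, ← sum_div, ← sum_div, tot₂, div_self hn'.ne']
  have scale : ∀ o : κ → ℝ, ∑ P, o P = n →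
      ∑ P, (Real.negMulLog (L' - o P) - Real.negMulLog L') =
      n * ∑ P, (Real.negMulLog (L' / n - o P / n) - Real.negMulLog (L' / n)) + n * Real.log n := by
    intro o ho
    rw [mul_sum]
    nth_rewrite 5 [← ho]
    rw [sum_mul, ← sum_add_distrib]
    refine sum_congr rfl fun P _ => ?_
    have e1 : L' - o P = n * (L' / n - o P / n) := by field_simp
    have e2 : Real.negMulLog L' = Real.negMulLog (n * (L' / n)) := by congr 1; field_simp
    rw [e1, e2, negMulLog_nat_mul, negMulLog_nat_mul]
    field_simp
    ring
  have scale3 : ∑ a, Real.negMulLog (m a) = n * ∑ a, Real.negMulLog ((m a : ℝ) / n) -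
      n * Real.log n := by
    rw [mul_sum]
    nth_rewrite 3 [← tot]
    rw [sum_mul, ← sum_sub_distrib]
    refine sum_congr rfl fun a _ => ?_
    have e1 : (m a : ℝ) = n * ((m a : ℝ) / n) := by field_simp
    rw [e1, negMulLog_nat_mul]
    field_simp
  have be : blockEntropy (L' / n) (fun a => (m a : ℝ) / n) =
      ∑ P, (Real.negMulLog (L' / n - o₁ P / n) - Real.negMulLog (L' / n)) +
      ∑ P, (Real.negMulLog (L' / n - o₂ P / n) - Real.negMulLog (L' / n)) +
      ∑ a, Real.negMulLog ((m a : ℝ) / n) := by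
    simp only [blockEntropy, ← sum_div, ho₁, ho₂]
  have s1 := scale o₁ tot₁
  have s2 := scale o₂ tot₂
  have f1 := sum_log_one_sub n
  have f2 := sum_log_one_sub_add_le n c hn
  have f3 := log_factorial_sub_le n hn
  have e0 : 2 / δ = 1 / δ + 1 / δ := by ring
  rw [← div_le_one (Real.exp_pos _), div_eq_mul_inv, ← Real.exp_neg]
  refine le_trans (mul_le_mul_of_nonneg_left (Real.exp_le_exp.2 ?_) (Nat.cast_nonneg _)) hmain
  rw [ent, mass, be, scale3]
  simp only [mul_add, mul_sub]
  linarith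

theorem negMulLog_le_rpow {h : ℝ} (h0 : 0 ≤ h) : Real.negMulLog h ≤ 4 * h ^ (3 / 4 : ℝ) := by
  rcases h0.eq_or_lt with rfl | h0
  · simp [Real.zero_rpow]
  have h1 := Real.log_le_rpow_div (x := h⁻¹) (by positivity) (ε := 1 / 4) (by norm_num)
  rw [Real.log_inv, Real.inv_rpow h0.le] at h1
  have h2 := mul_le_mul_of_nonneg_left h1 h0.le
  have e : h ^ (3 / 4 : ℝ) = h * (h ^ (1 / 4 : ℝ))⁻¹ := by
    rw [← Real.rpow_neg h0.le]
    nth_rewrite 2 [← Real.rpow_one h]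
    rw [← Real.rpow_add h0]; norm_num
  rw [e, Real.negMulLog]
  calc -h * Real.log h = h * -Real.log h := by ring
    _ ≤ _ := h2
    _ = _ := by ring

theorem abs_negMulLog_sub_le {x y : ℝ} (hx : x ∈ Set.Icc (0 : ℝ) 1) (hy : y ∈ Set.Icc (0 : ℝ) 1) :
    |Real.negMulLog x - Real.negMulLog y| ≤ 4 * |x - y| ^ (3 / 4 : ℝ) := by
  wlog hxy : x ≤ y generalizing x y
  · rw [abs_sub_comm, abs_sub_comm x]; exact this hy hx (le_of_not_ge hxy)
  set h := y - x with hh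
  have h0 : 0 ≤ h := sub_nonneg.2 hxy
  have hy' : y = x + h := by rw [hh]; ring
  rw [abs_sub_comm x, abs_of_nonneg h0]
  rcases hx.1.eq_or_lt with hx0 | hx0
  · have : y = h := by rw [hh, ← hx0, sub_zero]
    rw [← hx0, Real.negMulLog_zero, zero_sub, abs_neg, abs_of_nonneg
      (Real.negMulLog_nonneg hy.1 hy.2), this]
    exact negMulLog_le_rpow h0
  rcases h0.eq_or_lt with hz | hz
  · have : y = x := by linarith
    rw [this, sub_self, abs_zero]; positivity
  rw [abs_le]
  constructor
  · have h1 : Real.log x ≤ Real.log y := Real.log_le_log hx0 hxy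
    have h2 : Real.log h ≤ Real.log y := Real.log_le_log hz (by linarith)
    have h3 := negMulLog_le_rpow h0
    simp only [Real.negMulLog] at *
    nlinarith
  · have h1 : Real.log y - Real.log x ≤ y / x - 1 := by
      rw [← Real.log_div (by linarith) hx0.ne']
      exact Real.log_le_sub_one_of_pos (div_pos (by linarith) hx0)
    have h2 := mul_le_mul_of_nonneg_left h1 hx0.le
    have e : x * (y / x - 1) = h := by field_simp; linarith
    have h3 : Real.log y ≤ 0 := Real.log_nonpos hy.1 hy.2
    have h4 : h ≤ h ^ (3 / 4 : ℝ) := by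
      nth_rewrite 1 [← Real.rpow_one h]
      exact Real.rpow_le_rpow_of_exponent_ge hz (by linarith [hy.2]) (by norm_num)
    have h5 : 0 ≤ h ^ (3 / 4 : ℝ) := by positivity
    simp only [Real.negMulLog]
    nlinarith

theorem negMulLog_add_le {x y : ℝ} (hx : 0 ≤ x) (hy : 0 ≤ y) :
    Real.negMulLog x + Real.negMulLog y ≤ Real.negMulLog (x + y) + (x + y) * Real.log 2 := by
  have h := Real.concaveOn_negMulLog.2 (Set.mem_Ici.2 hx) (Set.mem_Ici.2 hy)
    (by norm_num : (0 : ℝ) ≤ 1 / 2) (by norm_num : (0 : ℝ) ≤ 1 / 2) (by norm_num)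
  simp only [smul_eq_mul] at h
  have e : Real.negMulLog (1 / 2 * x + 1 / 2 * y) =
      1 / 2 * Real.negMulLog (x + y) + 1 / 2 * (x + y) * Real.log 2 := by
    rw [← mul_add, Real.negMulLog_mul]
    simp only [Real.negMulLog, one_div, Real.log_inv]; ring
  linarith

theorem negMulLog_two_mul (x : ℝ) :
    Real.negMulLog (2 * x) = 2 * Real.negMulLog x - 2 * x * Real.log 2 :=
  negMulLog_nat_mul 2 x

/-- Merging the two parity classes of diagonals. -/
theorem blockEntropy_le_merge {κ : Type*} [Fintype κ] {ℓ : ℝ}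
    {x : (κ × Fin 2) × (κ × Fin 2) → ℝ} (hx : ∀ a, 0 ≤ x a) (htot : ∑ a, x a = 1)
    (hpar : ∀ P Q : κ × Fin 2, P.2 ≠ Q.2 → x (P, Q) = 0)
    (h₁ : ∀ P, ∑ Q, x (P, Q) ≤ ℓ) (h₂ : ∀ Q, ∑ P, x (P, Q) ≤ ℓ) :
    blockEntropy ℓ x ≤
      blockEntropy (2 * ℓ) (fun a : κ × κ => ∑ p, ∑ p', x ((a.1, p), (a.2, p'))) - Real.log 2 := by
  have h01 : ∀ s s', x ((s, 0), (s', 1)) = 0 := fun s s' => hpar _ _ (by simp)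
  have h10 : ∀ s s', x ((s, 1), (s', 0)) = 0 := fun s s' => hpar _ _ (by simp)
  have tot₁ : ∑ P, ∑ Q, x (P, Q) = 1 := by rw [← Fintype.sum_prod_type']; exact htot
  have tot₂ : ∑ Q, ∑ P, x (P, Q) = 1 := by rw [sum_comm]; exact tot₁
  have marg : ∀ g : κ × Fin 2 → ℝ, (∀ P, g P ≤ ℓ) → ∑ P, g P = 1 →
      ∑ P, (Real.negMulLog (ℓ - g P) - Real.negMulLog ℓ) ≤
      ∑ s, (Real.negMulLog (2 * ℓ - (g (s, 0) + g (s, 1))) - Real.negMulLog (2 * ℓ)) -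
        Real.log 2 := by
    intro g hg hg1
    rw [Fintype.sum_prod_type] at hg1 ⊢
    simp only [Fin.sum_univ_two] at hg1 ⊢
    have : Real.log 2 = ∑ s, (g (s, 0) + g (s, 1)) * Real.log 2 := by
      rw [← sum_mul, hg1, one_mul]
    rw [this, ← sum_sub_distrib]
    refine sum_le_sum fun s _ => ?_
    have := negMulLog_add_le (sub_nonneg.2 (hg (s, 0))) (sub_nonneg.2 (hg (s, 1)))
    rw [show ℓ - g (s, 0) + (ℓ - g (s, 1)) = 2 * ℓ - (g (s, 0) + g (s, 1)) by ring] at this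
    have e := negMulLog_two_mul ℓ
    linarith
  have cells : ∑ a, Real.negMulLog (x a) ≤
      ∑ a : κ × κ, Real.negMulLog (∑ p, ∑ p', x ((a.1, p), (a.2, p'))) + Real.log 2 := by
    have e1 : ∀ f : (κ × Fin 2) × (κ × Fin 2) → ℝ, ∑ a, f a =
        ∑ a : κ × κ, ∑ p, ∑ p', f ((a.1, p), (a.2, p')) := by
      intro f
      simp only [Fintype.sum_prod_type]
      refine sum_congr rfl fun s _ => ?_
      simp only [Fin.sum_univ_two, sum_add_distrib]
    have : Real.log 2 = ∑ a : κ × κ, (∑ p, ∑ p', x ((a.1, p), (a.2, p'))) * Real.log 2 := by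
      rw [← sum_mul, ← e1, htot, one_mul]
    rw [this, ← sum_add_distrib, e1]
    refine sum_le_sum fun a _ => ?_
    simp only [Fin.sum_univ_two, h01, h10, Real.negMulLog_zero, add_zero, zero_add]
    exact negMulLog_add_le (hx _) (hx _)
  have m1 := marg (fun P => ∑ Q, x (P, Q)) h₁ tot₁
  have m2 := marg (fun Q => ∑ P, x (P, Q)) h₂ tot₂
  have r1 : ∀ s, ∑ Q : κ × Fin 2, x ((s, 0), Q) + ∑ Q : κ × Fin 2, x ((s, 1), Q) =
      ∑ s', ∑ p, ∑ p', x ((s, p), (s', p')) := by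
    intro s
    simp only [Fintype.sum_prod_type, Fin.sum_univ_two, sum_add_distrib]
    ring
  have r2 : ∀ s, ∑ Q : κ × Fin 2, x (Q, (s, 0)) + ∑ Q : κ × Fin 2, x (Q, (s, 1)) =
      ∑ s', ∑ p, ∑ p', x ((s', p), (s, p')) := by
    intro s
    simp only [Fintype.sum_prod_type, Fin.sum_univ_two, sum_add_distrib]
  simp only [r1] at m1
  simp only [r2] at m2
  unfold blockEntropy
  linarith

/-- Stability of the entropy functional on a `2N × 2N` array. -/
theorem blockEntropy_le_of_close {N : ℕ} (hN : 0 < N) {ε ℓ ℓ' : ℝ} (hε : 0 < ε)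
    {y z : Fin (2 * N) × Fin (2 * N) → ℝ}
    (hy : ∀ a, 0 ≤ y a) (hz : ∀ a, 0 ≤ z a) (hℓ : ℓ ≤ 1) (hℓ' : ℓ' ≤ 1)
    (hy₁ : ∀ s, ∑ t, y (s, t) ≤ ℓ) (hy₂ : ∀ t, ∑ s, y (s, t) ≤ ℓ)
    (hz₁ : ∀ s, ∑ t, z (s, t) ≤ ℓ') (hz₂ : ∀ t, ∑ s, z (s, t) ≤ ℓ')
    (hyz : ∀ a, |y a - z a| ≤ 2 * ε) (hℓℓ : |ℓ - ℓ'| ≤ ε) :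
    blockEntropy ℓ y ≤ blockEntropy ℓ' z + 200 * N ^ 2 * ε ^ (3 / 4 : ℝ) := by
  have hN1 : (1 : ℝ) ≤ N := by exact_mod_cast hN
  have : Nonempty (Fin (2 * N)) := ⟨⟨0, by omega⟩⟩
  have ℓ0 : 0 ≤ ℓ := (sum_nonneg fun t _ => hy (Classical.arbitrary _, t)).trans
    (hy₁ (Classical.arbitrary _))
  have ℓ'0 : 0 ≤ ℓ' := (sum_nonneg fun t _ => hz (Classical.arbitrary _, t)).trans
    (hz₁ (Classical.arbitrary _))
  have bound : ∀ {u v K : ℝ}, 1 ≤ K → u ∈ Set.Icc (0 : ℝ) 1 → v ∈ Set.Icc (0 : ℝ) 1 →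
      |u - v| ≤ K * ε → |Real.negMulLog u - Real.negMulLog v| ≤ 4 * K * ε ^ (3 / 4 : ℝ) := by
    intro u v K hK hu hv h
    refine (abs_negMulLog_sub_le hu hv).trans ?_
    have h1 : |u - v| ^ (3 / 4 : ℝ) ≤ (K * ε) ^ (3 / 4 : ℝ) :=
      Real.rpow_le_rpow (abs_nonneg _) h (by norm_num)
    have h2 : (K * ε) ^ (3 / 4 : ℝ) ≤ K * ε ^ (3 / 4 : ℝ) := by
      rw [Real.mul_rpow (by linarith) hε.le]
      gcongr
      nth_rewrite 2 [← Real.rpow_one K]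
      exact Real.rpow_le_rpow_of_exponent_le hK (by norm_num)
    linarith
  have E0 : 0 ≤ ε ^ (3 / 4 : ℝ) := by positivity
  have marg : ∀ g g' : Fin (2 * N) → ℝ, (∀ s, 0 ≤ g s) → (∀ s, 0 ≤ g' s) → (∀ s, g s ≤ ℓ) →
      (∀ s, g' s ≤ ℓ') → (∀ s, |g s - g' s| ≤ 2 * N * (2 * ε)) →
      ∑ s, (Real.negMulLog (ℓ - g s) - Real.negMulLog ℓ) ≤
        ∑ s, (Real.negMulLog (ℓ' - g' s) - Real.negMulLog ℓ') +
          48 * N ^ 2 * ε ^ (3 / 4 : ℝ) := by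
    intro g g' hg hg' hgl hgl' hgg
    have : 48 * (N : ℝ) ^ 2 * ε ^ (3 / 4 : ℝ) =
        ∑ _s : Fin (2 * N), 24 * N * ε ^ (3 / 4 : ℝ) := by
      simp; ring
    rw [this, ← sum_add_distrib]
    refine sum_le_sum fun s _ => ?_
    have b1 := bound (K := 5 * N) (by linarith)
      (u := ℓ - g s) (v := ℓ' - g' s) ⟨sub_nonneg.2 (hgl s), by linarith [hg s]⟩
      ⟨sub_nonneg.2 (hgl' s), by linarith [hg' s]⟩ (by
        have h1 := abs_le.1 (hgg s)
        have h2 := abs_le.1 hℓℓ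
        rw [abs_le]
        constructor <;> nlinarith)
    have b2 := bound (K := 1) le_rfl (u := ℓ) (v := ℓ') ⟨ℓ0, hℓ⟩ ⟨ℓ'0, hℓ'⟩ (by linarith)
    have c1 := abs_le.1 b1
    have c2 := abs_le.1 b2
    nlinarith
  have sumclose : ∀ f f' : Fin (2 * N) → ℝ, (∀ t, |f t - f' t| ≤ 2 * ε) →
      |∑ t, f t - ∑ t, f' t| ≤ 2 * N * (2 * ε) := by
    intro f f' h
    rw [← sum_sub_distrib]
    refine (abs_sum_le_sum_abs _ _).trans ((sum_le_sum fun t _ => h t).trans (le_of_eq ?_))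
    simp
  have m1 := marg (fun s => ∑ t, y (s, t)) (fun s => ∑ t, z (s, t))
    (fun s => sum_nonneg fun t _ => hy _) (fun s => sum_nonneg fun t _ => hz _) hy₁ hz₁
    (fun s => sumclose _ _ fun t => hyz _)
  have m2 := marg (fun t => ∑ s, y (s, t)) (fun t => ∑ s, z (s, t))
    (fun s => sum_nonneg fun t _ => hy _) (fun s => sum_nonneg fun t _ => hz _) hy₂ hz₂
    (fun s => sumclose _ _ fun t => hyz _)
  have m3 : ∑ a, Real.negMulLog (y a) ≤ ∑ a, Real.negMulLog (z a) +
      32 * N ^ 2 * ε ^ (3 / 4 : ℝ) := by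
    have : 32 * (N : ℝ) ^ 2 * ε ^ (3 / 4 : ℝ) =
        ∑ _a : Fin (2 * N) × Fin (2 * N), 8 * ε ^ (3 / 4 : ℝ) := by
      simp; ring
    rw [this, ← sum_add_distrib]
    refine sum_le_sum fun a _ => ?_
    have hy1 : y a ≤ 1 := (single_le_sum (f := fun t => y (a.1, t)) (fun t _ => hy _)
      (mem_univ a.2)).trans ((hy₁ a.1).trans hℓ)
    have hz1 : z a ≤ 1 := (single_le_sum (f := fun t => z (a.1, t)) (fun t _ => hz _)
      (mem_univ a.2)).trans ((hz₁ a.1).trans hℓ')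
    have := abs_le.1 (bound (K := 2) (by norm_num) ⟨hy a, hy1⟩ ⟨hz a, hz1⟩ (hyz a))
    linarith
  have : 0 ≤ (N : ℝ) ^ 2 * ε ^ (3 / 4 : ℝ) := by positivity
  simp only [blockEntropy]
  linarith

/-- A set of integers of the same parity and diameter less than `n / N` is small. -/
theorem card_le_of_same_parity {N n : ℕ} (hN : 0 < N) {S : Finset ℕ}
    (hS : ∀ w ∈ S, ∀ w' ∈ S, w ≤ w' → N * (w' - w) < n ∧ w % 2 = w' % 2) :
    (#S : ℝ) ≤ n / (2 * N) + 1 := by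
  rcases S.eq_empty_or_nonempty with rfl | hne
  · simp; positivity
  set w₀ := S.min' hne with hw₀
  have hmem : w₀ ∈ S := S.min'_mem hne
  have hle : ∀ w ∈ S, w₀ ≤ w := fun w hw => S.min'_le w hw
  have hcard : #S ≤ #(range (n / (2 * N) + 1)) := by
    refine card_le_card_of_injOn (fun w => (w - w₀) / 2) (fun w hw => ?_) fun w hw w' hw' e => ?_
    · have h1 := (hS w₀ hmem w hw (hle w hw)).1
      have h2 : (w - w₀) / 2 * 2 ≤ w - w₀ := Nat.div_mul_le_self _ _
      simp only [coe_range, Set.mem_Iio]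
      rw [Nat.lt_succ_iff, Nat.le_div_iff_mul_le (by omega)]
      nlinarith
    · have h1 := (hS w₀ hmem w hw (hle w hw)).2
      have h2 := (hS w₀ hmem w' hw' (hle w' hw')).2
      have h3 := hle w hw
      have h4 := hle w' hw'
      simp only at e
      omega
  rw [card_range] at hcard
  have h1 : (#S : ℝ) ≤ ((n / (2 * N) + 1 : ℕ) : ℝ) := by exact_mod_cast hcard
  refine h1.trans ?_
  push_cast
  gcongr
  exact_mod_cast Nat.cast_div_le (α := ℝ) (m := n) (n := 2 * N)

/-- Blocks of diagonals: consecutive diagonals are grouped into `2N` intervals, each of which is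
split according to parity. The shift `r` aligns the parities of the two families. -/
def diagBlock (N n r : ℕ) [NeZero N] (w : ℕ) : Fin (2 * N) × Fin 2 :=
  (Fin.ofNat (2 * N) (N * w / n), Fin.ofNat 2 (w + r))

theorem mul_div_lt_two_mul {N n w : ℕ} (hN : 0 < N) (hw : w < 2 * n) : N * w / n < 2 * N := by
  rw [Nat.div_lt_iff_lt_mul (by omega)]
  nlinarith

theorem diagBlock_fst_eq_iff {N n r w : ℕ} [NeZero N] (hw : w < 2 * n) (s : Fin (2 * N)) :
    (diagBlock N n r w).1 = s ↔ N * w / n = s := by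
  rw [Fin.ext_iff]
  simp only [diagBlock, Fin.val_ofNat]
  rw [Nat.mod_eq_of_lt (mul_div_lt_two_mul (Nat.pos_of_ne_zero (NeZero.ne N)) hw)]

theorem card_diagBlock_le {N n : ℕ} [NeZero N] (hn : 0 < n) (r : ℕ) (P : Fin (2 * N) × Fin 2) :
    (#{w ∈ range (2 * n) | diagBlock N n r w = P} : ℝ) ≤ n / (2 * N) + 1 := by
  refine card_le_of_same_parity (Nat.pos_of_ne_zero (NeZero.ne N)) fun w hw w' hw' hle => ?_
  simp only [mem_filter, mem_range] at hw hw'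
  have h1 := (diagBlock_fst_eq_iff hw.1 P.1).1 (by rw [hw.2])
  have h2 := (diagBlock_fst_eq_iff hw'.1 P.1).1 (by rw [hw'.2])
  have h3 : (diagBlock N n r w).2 = (diagBlock N n r w').2 := by rw [hw.2, hw'.2]
  simp only [diagBlock, Fin.ext_iff, Fin.val_ofNat] at h3
  refine ⟨?_, by omega⟩
  have h4 := Nat.div_mul_le_self (N * w) n
  have h5 := Nat.lt_div_mul_add (a := N * w') hn
  rw [h1] at h4
  rw [h2] at h5
  rw [Nat.mul_sub]
  omega

/-- The number of queens of `q` in the intersection of two intervals of diagonals. -/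
def cellCount (N n : ℕ) (q : Finset (ℕ × ℕ)) (s t : ℕ) : ℕ :=
  #{x ∈ q | N * plusIdx x / n = s ∧ N * minusIdx n x / n = t}

theorem sum_blockCount_parity {N n : ℕ} [NeZero N] {q : Finset (ℕ × ℕ)} (hq : IsQueensConfig n q)
    (r₁ r₂ : ℕ) (s t : Fin (2 * N)) :
    ∑ p, ∑ p', blockCount n (diagBlock N n r₁) (diagBlock N n r₂) q ((s, p), (t, p')) =
      cellCount N n q s t := by
  rw [cellCount, card_eq_sum_card_fiberwise
    (f := fun x => ((diagBlock N n r₁ (plusIdx x)).2, (diagBlock N n r₂ (minusIdx n x)).2))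
    (t := univ) (by simp), Fintype.sum_prod_type]
  refine sum_congr rfl fun p _ => sum_congr rfl fun p' _ => ?_
  rw [blockCount, filter_filter]
  congr 1
  refine filter_congr fun x hx => ?_
  have hx' := hq.subset_board hx
  have h1 := diagBlock_fst_eq_iff (N := N) (r := r₁) (plusIdx_lt hx') s
  have h2 := diagBlock_fst_eq_iff (N := N) (r := r₂) (minusIdx_lt hx') t
  rw [← h1, ← h2]
  simp only [blockPair, Prod.ext_iff]
  tauto

theorem blockCount_parity {N n : ℕ} [NeZero N] {q : Finset (ℕ × ℕ)} (hq : IsQueensConfig n q)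
    (P Q : Fin (2 * N) × Fin 2) (h : P.2 ≠ Q.2) :
    blockCount n (diagBlock N n 0) (diagBlock N n (n + 1)) q (P, Q) = 0 := by
  rw [blockCount, card_eq_zero, filter_eq_empty_iff]
  intro x hx e
  have hx' := mem_board.1 (hq.subset_board hx)
  simp only [blockPair, Prod.mk.injEq] at e
  apply h
  rw [← e.1, ← e.2]
  simp only [diagBlock, Fin.ext_iff, Fin.val_ofNat, plusIdx, minusIdx]
  omega

theorem card_queens_close_le {N : ℕ} (hN : 2 ≤ N) {ε : ℝ} (hε : 0 < ε) (hε' : ε ≤ 1 / 2) {c : ℕ}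
    (hc : 2 * N ≤ c * (ε / 2) ^ 2) {n : ℕ} (hn : 8 / ε ≤ n)
    {z : Fin (2 * N) × Fin (2 * N) → ℝ} (hz : ∀ a, 0 ≤ z a)
    (hz₁ : ∀ s, ∑ t, z (s, t) ≤ 1 / N) (hz₂ : ∀ t, ∑ s, z (s, t) ≤ 1 / N)
    {B : Finset (Finset (ℕ × ℕ))}
    (hB : ∀ q ∈ B, IsQueensConfig n q ∧
      ∀ s t : Fin (2 * N), |(cellCount N n q s t : ℝ) / n - z (s, t)| ≤ 2 * ε) :
    (#B : ℝ) ≤ Real.exp (n * (Real.log n - 3 - Real.log 2 + blockEntropy (1 / N) z +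
      200 * N ^ 2 * ε ^ (3 / 4 : ℝ)) + ((4 * N) ^ 2 * Real.log (n + 1) +
        (Real.log (n + 1) + 1 + c * (1 + Real.log n) + 4 / ε))) := by
  have hN0 : 0 < N := by omega
  have : NeZero N := ⟨hN0.ne'⟩
  have hN2 : (2 : ℝ) ≤ N := by exact_mod_cast hN
  have hn' : (0 : ℝ) < n := lt_of_lt_of_le (by positivity) hn
  have hn0 : 0 < n := by exact_mod_cast hn'
  set b₁ := diagBlock N n 0
  set b₂ := diagBlock N n (n + 1)
  set L : ℝ := n / (2 * N) + 1 with hL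
  set δ : ℝ := ε / 2 with hδ
  have hδ0 : 0 < δ := by positivity
  have hL0 : 0 < L := by positivity
  have hcL : (n : ℝ) ≤ c * (δ ^ 2 * L) := by
    have h1 : (n : ℝ) / (2 * N) ≤ L := by rw [hL]; linarith
    calc (n : ℝ) = 2 * N * (n / (2 * N)) := by field_simp
      _ ≤ c * δ ^ 2 * L := by gcongr
      _ = _ := by ring
  set ℓ : ℝ := (1 + δ) * L / n with hℓ
  have hℓ2 : 2 * ℓ = 1 / N + δ * (1 / N) + 2 * (1 + δ) / n := by
    rw [hℓ, hL]; field_simp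
  have hinv : (1 : ℝ) / N ≤ 1 / 2 := one_div_le_one_div_of_le (by norm_num) hN2
  have hinv0 : (0 : ℝ) < 1 / N := by positivity
  have hclose : |2 * ℓ - 1 / N| ≤ ε := by
    have h1 : δ * (1 / N) ≤ ε / 4 := by nlinarith
    have h2 : 2 * (1 + δ) / n ≤ ε / 2 := by
      rw [div_le_iff₀ hn']
      rw [div_le_iff₀ hε] at hn
      nlinarith
    have h3 : 0 ≤ δ * (1 / N) := by positivity
    have h4 : 0 ≤ 2 * (1 + δ) / n := by positivity
    rw [hℓ2, abs_le]; constructor <;> linarith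
  set X : ℝ := n * (Real.log n - 3 - Real.log 2 + blockEntropy (1 / N) z +
      200 * N ^ 2 * ε ^ (3 / 4 : ℝ)) + (Real.log (n + 1) + 1 + c * (1 + Real.log n) + 4 / ε) with hX
  have fiber : ∀ m, (#{q ∈ B | blockCount n b₁ b₂ q = m} : ℝ) ≤ Real.exp X := by
    intro m
    rcases (B.filter fun q => blockCount n b₁ b₂ q = m).eq_empty_or_nonempty with he | ⟨q₀, hq₀⟩
    · rw [he]; simp; positivity
    refine (card_queens_of_type_le_exp hn0 b₁ b₂ hL0 hδ0 (card_diagBlock_le hn0 0)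
      (card_diagBlock_le hn0 (n + 1)) hcL m _ fun q hq => ?_).trans (Real.exp_le_exp.2 ?_)
    · rw [mem_filter] at hq; exact ⟨(hB q hq.1).1, hq.2⟩
    obtain ⟨hqB, hm⟩ := mem_filter.1 hq₀
    obtain ⟨hq, hqz⟩ := hB q₀ hqB
    have tot : ∑ a, (m a : ℝ) / n = 1 := by
      rw [← sum_div, div_eq_one_iff_eq hn'.ne', ← hm]
      exact_mod_cast (sum_blockCount n b₁ b₂ q₀).trans hq.card
    have hLl : L / n ≤ ℓ := by
      rw [hℓ]; gcongr; nlinarith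
    have le_fst : ∀ P, ∑ Q, (m (P, Q) : ℝ) / n ≤ ℓ := fun P => by
      refine le_trans ?_ hLl
      rw [← sum_div]
      gcongr
      refine le_trans ?_ (card_diagBlock_le hn0 0 P)
      rw [← hm]
      exact_mod_cast (sum_blockCount_fst n b₁ b₂ q₀ P) ▸
        card_block_le (plusIdx_injOn hq) (fun x hx => plusIdx_lt (hq.subset_board hx)) b₁ P
    have le_snd : ∀ Q, ∑ P, (m (P, Q) : ℝ) / n ≤ ℓ := fun Q => by
      refine le_trans ?_ hLl
      rw [← sum_div]
      gcongr
      refine le_trans ?_ (card_diagBlock_le hn0 (n + 1) Q)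
      rw [← hm]
      exact_mod_cast (sum_blockCount_snd n b₁ b₂ q₀ Q) ▸
        card_block_le (minusIdx_injOn hq) (fun x hx => minusIdx_lt (hq.subset_board hx)) b₂ Q
    have par : ∀ P Q : Fin (2 * N) × Fin 2, P.2 ≠ Q.2 → (m (P, Q) : ℝ) / n = 0 := by
      intro P Q h
      rw [← hm, blockCount_parity hq P Q h]; simp
    have h1 := blockEntropy_le_merge (fun a => by positivity) tot par le_fst le_snd
    have cells : ∀ a : Fin (2 * N) × Fin (2 * N),
        ∑ p, ∑ p', (m ((a.1, p), (a.2, p')) : ℝ) / n = (cellCount N n q₀ a.1 a.2 : ℝ) / n := by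
      intro a
      simp only [← sum_div]
      rw [← sum_blockCount_parity hq 0 (n + 1) a.1 a.2, ← hm]
      push_cast; rfl
    have h2 := blockEntropy_le_of_close hN0 hε (ℓ := 2 * ℓ) (ℓ' := 1 / N)
      (y := fun a => ∑ p, ∑ p', (m ((a.1, p), (a.2, p')) : ℝ) / n) (z := z)
      (fun a => sum_nonneg fun _ _ => sum_nonneg fun _ _ => by positivity) hz
      (by linarith [(abs_le.1 hclose).2]) (by linarith)
      (fun s => by
        have a1 := le_fst (s, 0)
        have a2 := le_fst (s, 1)
        simp only [Fintype.sum_prod_type, Fin.sum_univ_two, sum_add_distrib] at a1 a2 ⊢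
        linarith)
      (fun s => by
        have a1 := le_snd (s, 0)
        have a2 := le_snd (s, 1)
        simp only [Fintype.sum_prod_type, Fin.sum_univ_two, sum_add_distrib] at a1 a2 ⊢
        linarith)
      hz₁ hz₂ (fun a => by rw [cells a]; exact hqz a.1 a.2) hclose
    have h3 := mul_le_mul_of_nonneg_left (h1.trans (sub_le_sub_right h2 _)) hn'.le
    have e : 2 / δ = 4 / ε := by rw [hδ]; field_simp; norm_num
    rw [hX, e]
    linarith
  have count : (#B : ℝ) ≤ (n + 1) ^ ((4 * N) ^ 2) * Real.exp X := by
    set T : Finset ((Fin (2 * N) × Fin 2) × (Fin (2 * N) × Fin 2) → ℕ) :=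
      Fintype.piFinset fun _ => range (n + 1) with hT
    have hTc : #T = (n + 1) ^ ((4 * N) ^ 2) := by
      rw [hT, Fintype.card_piFinset]
      simp only [card_range, prod_const, card_univ, Fintype.card_prod, Fintype.card_fin]
      congr 1; ring
    have hmaps : ∀ q ∈ B, blockCount n b₁ b₂ q ∈ T := by
      intro q hq
      rw [hT, Fintype.mem_piFinset]
      intro a
      rw [mem_range, Nat.lt_succ_iff, ← (hB q hq).1.card]
      exact card_filter_le _ _
    rw [card_eq_sum_card_fiberwise hmaps]
    push_cast
    refine (sum_le_sum fun m _ => fiber m).trans (le_of_eq ?_)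
    rw [sum_const, nsmul_eq_mul, hTc]
    push_cast; rfl
  refine count.trans (le_of_eq ?_)
  have : ((n : ℝ) + 1) ^ ((4 * N) ^ 2) = Real.exp ((4 * N) ^ 2 * Real.log (n + 1)) := by
    rw [show ((4 * N : ℝ)) ^ 2 = (((4 * N) ^ 2 : ℕ) : ℝ) by push_cast; rfl, Real.exp_nat_mul,
      Real.exp_log (by positivity)]
  rw [this, ← Real.exp_add, hX]
  congr 1
  ring

end Counting

theorem measure_le_volume_of_Ioo {ν : Measure ℝ}
    (h : ∀ a b : ℝ, ν (Set.Ioo a b) ≤ ENNReal.ofReal (b - a)) : ν ≤ volume := by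
  have hIoc : ∀ a b : ℝ, ν (Set.Ioc a b) ≤ ENNReal.ofReal (b - a) := by
    intro a b
    rcases lt_or_ge b a with hab | hab
    · rw [Set.Ioc_eq_empty (by linarith)]; simp
    refine ENNReal.le_of_forall_pos_le_add fun δ hδ _ => ?_
    have : Set.Ioc a b ⊆ Set.Ioo a (b + δ) :=
      fun x hx => ⟨hx.1, hx.2.trans_lt (by simpa using hδ)⟩
    refine (measure_mono this).trans ((h _ _).trans ?_)
    rw [show b + δ - a = (b - a) + δ by ring, ENNReal.ofReal_add (sub_nonneg.2 hab) δ.coe_nonneg]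
    simp
  refine Measure.le_iff'.2 fun s => ?_
  rw [Real.volume_val, StieltjesFunction.measure]
  have key : ν.toOuterMeasure ≤ StieltjesFunction.id.outer := by
    refine OuterMeasure.le_ofFunction.2 fun t => ?_
    rw [StieltjesFunction.length_eq]
    refine le_iInf fun a => le_iInf fun b => le_iInf fun ht => ?_
    refine (measure_mono fun x hx => ht ⟨hx, ?_⟩).trans (hIoc a b)
    exact notMem_botSet_of_lt (sub_one_lt x)
  exact key s

theorem queenon_open_le {γ : ProbabilityMeasure (ℝ × ℝ)} (hγ : γ ∈ queenons) {U : Set (ℝ × ℝ)}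
    (hU : IsOpen U) {K : ℝ≥0∞} (h : ∀ μ : ProbabilityMeasure (ℝ × ℝ), IsStepPermuton μ.toMeasure →
      SubUniformDiag μ.toMeasure → μ.toMeasure U ≤ K) : γ.toMeasure U ≤ K := by
  have := mem_closure_iff_nhdsWithin_neBot.1 hγ
  refine (ProbabilityMeasure.le_liminf_measure_open_of_tendsto (μs := id)
    (L := 𝓝[{μ | IsStepPermuton μ.toMeasure ∧ SubUniformDiag μ.toMeasure}] γ)
    (tendsto_id.mono_left nhdsWithin_le_nhds) hU).trans ?_
  refine (liminf_le_liminf (eventually_nhdsWithin_of_forall fun μ hμ => h μ hμ.1 hμ.2)).trans ?_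
  simp

theorem queenon_compl_unitSq {γ : ProbabilityMeasure (ℝ × ℝ)} (hγ : γ ∈ queenons) :
    γ.toMeasure unitSqᶜ = 0 := by
  refine le_antisymm (queenon_open_le hγ ?_ fun μ hμ _ => ?_) zero_le
  · exact (isClosed_Icc.prod isClosed_Icc).isOpen_compl
  · obtain ⟨N, _, hN⟩ := hμ
    exact hN.1.2.1.le

/-- A linear functional bounded by `r` on the square whose closed strips satisfy a linear measure
bound pushes a queenon forward to a measure dominated by Lebesgue measure. -/
theorem queenon_map_le {γ : ProbabilityMeasure (ℝ × ℝ)} (hγ : γ ∈ queenons) {f : ℝ × ℝ → ℝ}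
    (hf : Continuous f) {r : ℝ} (hr : ∀ p ∈ unitSq, f p ∈ Set.Icc (-r) r)
    (h : ∀ μ : ProbabilityMeasure (ℝ × ℝ), IsStepPermuton μ.toMeasure →
      SubUniformDiag μ.toMeasure → ∀ a b : ℝ, -r ≤ a → a ≤ b → b ≤ r →
      μ.toMeasure {p ∈ unitSq | f p ∈ Set.Icc a b} ≤ ENNReal.ofReal (b - a)) :
    γ.toMeasure.map f ≤ volume := by
  refine measure_le_volume_of_Ioo fun a b => ?_
  rw [Measure.map_apply hf.measurable measurableSet_Ioo]
  refine queenon_open_le hγ (isOpen_Ioo.preimage hf) fun μ hμ hμ' => ?_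
  have h0 : μ.toMeasure unitSqᶜ = 0 := by obtain ⟨N, _, hN⟩ := hμ; exact hN.1.2.1
  have hsub : f ⁻¹' Set.Ioo a b ⊆
      {p ∈ unitSq | f p ∈ Set.Icc (max a (-r)) (min b r)} ∪ unitSqᶜ := by
    intro p hp
    by_cases hpq : p ∈ unitSq
    · exact Or.inl ⟨hpq, max_le hp.1.le (hr p hpq).1, le_min hp.2.le (hr p hpq).2⟩
    · exact Or.inr hpq
  refine (measure_mono hsub).trans ((measure_union_le _ _).trans ?_)
  rw [h0, add_zero]
  rcases le_or_gt (max a (-r)) (min b r) with hab | hab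
  · refine (h μ hμ hμ' _ _ (le_max_right _ _) hab (min_le_right _ _)).trans ?_
    exact ENNReal.ofReal_le_ofReal (by linarith [le_max_left a (-r), min_le_left b r])
  · rw [Set.Icc_eq_empty (not_le.2 hab)]; simp

theorem queenon_map_add_le {γ : ProbabilityMeasure (ℝ × ℝ)} (hγ : γ ∈ queenons) :
    γ.toMeasure.map (fun p => p.1 + p.2) ≤ volume := by
  refine queenon_map_le hγ (by fun_prop) (r := 1) (fun p hp => ?_) fun μ _ hμ a b h1 h2 h3 =>
    (hμ a b h1 h2 h3).1
  obtain ⟨h1, h2⟩ := hp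
  constructor <;> linarith [h1.1, h1.2, h2.1, h2.2]

theorem queenon_map_sub_le {γ : ProbabilityMeasure (ℝ × ℝ)} (hγ : γ ∈ queenons) :
    γ.toMeasure.map (fun p => p.2 - p.1) ≤ volume := by
  refine queenon_map_le hγ (by fun_prop) (r := 1) (fun p hp => ?_) fun μ _ hμ a b h1 h2 h3 =>
    (hμ a b h1 h2 h3).2
  obtain ⟨h1, h2⟩ := hp
  constructor <;> linarith [h1.1, h1.2, h2.1, h2.2]

theorem queenon_map_fst_le {γ : ProbabilityMeasure (ℝ × ℝ)} (hγ : γ ∈ queenons) :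
    γ.toMeasure.map Prod.fst ≤ volume := by
  refine queenon_map_le hγ (by fun_prop) (r := 1 / 2) (fun p hp => ?_)
    fun μ hμ _ a b h1 h2 h3 => ?_
  · rw [← neg_div]; exact hp.1
  · obtain ⟨N, _, hN⟩ := hμ
    refine (measure_mono ?_).trans (hN.1.2.2 a b (by linarith) h2 h3).1.le
    exact fun p hp => ⟨hp.2, hp.1.2⟩

theorem queenon_map_snd_le {γ : ProbabilityMeasure (ℝ × ℝ)} (hγ : γ ∈ queenons) :
    γ.toMeasure.map Prod.snd ≤ volume := by
  refine queenon_map_le hγ (by fun_prop) (r := 1 / 2) (fun p hp => ?_)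
    fun μ hμ _ a b h1 h2 h3 => ?_
  · rw [← neg_div]; exact hp.2
  · obtain ⟨N, _, hN⟩ := hμ
    refine (measure_mono ?_).trans (hN.1.2.2 a b (by linarith) h2 h3).2.le
    exact fun p hp => ⟨hp.1.1, hp.2⟩

/-- Finite measures on the square whose diagonal marginals are dominated by Lebesgue measure. -/
structure DiagBounded (μ : Measure (ℝ × ℝ)) : Prop where
  compl_unitSq : μ unitSqᶜ = 0
  map_add_le : μ.map (fun p => p.1 + p.2) ≤ volume
  map_sub_le : μ.map (fun p => p.2 - p.1) ≤ volume

theorem queenon_diagBounded {γ : ProbabilityMeasure (ℝ × ℝ)} (hγ : γ ∈ queenons) :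
    DiagBounded γ.toMeasure :=
  ⟨queenon_compl_unitSq hγ, queenon_map_add_le hγ, queenon_map_sub_le hγ⟩

theorem DiagBounded.mono {μ ν : Measure (ℝ × ℝ)} (h : DiagBounded μ) (hν : ν ≤ μ) :
    DiagBounded ν where
  compl_unitSq := le_antisymm ((hν _).trans h.compl_unitSq.le) zero_le
  map_add_le := (Measure.map_mono hν (by fun_prop)).trans h.map_add_le
  map_sub_le := (Measure.map_mono hν (by fun_prop)).trans h.map_sub_le

theorem measure_JNcell_partial {ν : Measure ℝ} (hν : ν ≤ volume) {N : ℕ} (hN : 0 < N) (k : ℕ) :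
    ν (Set.Icc (-1) (-1 + (k : ℝ) / N)) = ∑ j ∈ Finset.range k, ν (JNcell N (j + 1)) := by
  have : NullSingletonClass ν := ⟨fun x => le_antisymm ((hν _).trans (by simp)) zero_le⟩
  have hN' : (0 : ℝ) < N := by exact_mod_cast hN
  induction k with
  | zero => simp
  | succ k ih =>
    rw [Finset.sum_range_succ, ← ih]
    have e : JNcell N (k + 1) = Set.Icc (-1 + (k : ℝ) / N) (-1 + ((k + 1 : ℕ) : ℝ) / N) := by
      simp [JNcell]
    have h1 : (-1 : ℝ) ≤ -1 + (k : ℝ) / N := by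
      have : 0 ≤ (k : ℝ) / N := by positivity
      linarith
    have h2 : (-1 : ℝ) + (k : ℝ) / N ≤ -1 + ((k + 1 : ℕ) : ℝ) / N := by
      gcongr; simp
    rw [e, ← measure_congr (Ioc_ae_eq_Icc (a := -1 + (k : ℝ) / N)),
      ← measure_union _ measurableSet_Ioc, Set.Icc_union_Ioc_eq_Icc h1 h2]
    exact Set.disjoint_left.2 fun x hx hx' => not_lt.2 hx.2 hx'.1

theorem sum_measure_JNcell {ν : Measure ℝ} (hν : ν ≤ volume) (hs : ν (Set.Icc (-1) 1)ᶜ = 0) {N : ℕ}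
    (hN : 0 < N) : ∑ j ∈ Finset.range (2 * N), ν (JNcell N (j + 1)) = ν Set.univ := by
  rw [← measure_JNcell_partial hν hN, show (-1 : ℝ) + ((2 * N : ℕ) : ℝ) / N = 1 by
    push_cast; field_simp; norm_num]
  rw [← measure_add_measure_compl (measurableSet_Icc (a := (-1 : ℝ)) (b := 1)), hs, add_zero]

theorem measurableSet_JNcell (N i : ℕ) : MeasurableSet (JNcell N i) := measurableSet_Icc

theorem INcell_eq (N i j : ℕ) : INcell N i j = unitSq ∩
    ((fun p : ℝ × ℝ => p.1 + p.2) ⁻¹' JNcell N i ∩ (fun p => p.2 - p.1) ⁻¹' JNcell N j) := rfl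

theorem measurable_add_coord : Measurable fun p : ℝ × ℝ => p.1 + p.2 := by fun_prop

theorem measurable_sub_coord : Measurable fun p : ℝ × ℝ => p.2 - p.1 := by fun_prop

theorem DiagBounded.measure_inter_unitSq {μ : Measure (ℝ × ℝ)} (h : DiagBounded μ)
    (s : Set (ℝ × ℝ)) : μ (unitSq ∩ s) = μ s := by
  rw [Set.inter_comm]
  exact measure_inter_conull h.compl_unitSq

theorem DiagBounded.diagPlus_compl {μ : Measure (ℝ × ℝ)} (h : DiagBounded μ) :
    diagPlus μ (Set.Icc (-1) 1)ᶜ = 0 := by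
  rw [diagPlus, Measure.map_apply measurable_add_coord measurableSet_Icc.compl]
  refine measure_mono_null (t := unitSqᶜ) (fun p hp hq => hp ?_) h.compl_unitSq
  obtain ⟨h1, h2⟩ := hq
  constructor <;> linarith [h1.1, h1.2, h2.1, h2.2]

theorem DiagBounded.diagMinus_compl {μ : Measure (ℝ × ℝ)} (h : DiagBounded μ) :
    diagMinus μ (Set.Icc (-1) 1)ᶜ = 0 := by
  rw [diagMinus, Measure.map_apply measurable_sub_coord measurableSet_Icc.compl]
  refine measure_mono_null (t := unitSqᶜ) (fun p hp hq => hp ?_) h.compl_unitSq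
  obtain ⟨h1, h2⟩ := hq
  constructor <;> linarith [h1.1, h1.2, h2.1, h2.2]

theorem DiagBounded.sum_INcell_right {μ : Measure (ℝ × ℝ)} (h : DiagBounded μ) {N : ℕ} (hN : 0 < N)
    (i : ℕ) : ∑ j ∈ Finset.range (2 * N), μ (INcell N i (j + 1)) = diagPlus μ (JNcell N i) := by
  set S : Set (ℝ × ℝ) := (fun p : ℝ × ℝ => p.1 + p.2) ⁻¹' JNcell N i with hS
  have hSm : MeasurableSet S := measurable_add_coord (measurableSet_JNcell N i)
  have hr : DiagBounded (μ.restrict S) := h.mono Measure.restrict_le_self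
  have := sum_measure_JNcell hr.map_sub_le hr.diagMinus_compl hN
  rw [Measure.map_apply measurable_sub_coord MeasurableSet.univ, Set.preimage_univ,
    Measure.restrict_apply MeasurableSet.univ, Set.univ_inter] at this
  rw [diagPlus, Measure.map_apply measurable_add_coord (measurableSet_JNcell N i), ← hS, ← this]
  refine Finset.sum_congr rfl fun j _ => ?_
  rw [INcell_eq, h.measure_inter_unitSq, Measure.map_apply measurable_sub_coord
    (measurableSet_JNcell _ _), Measure.restrict_apply (measurable_sub_coord
    (measurableSet_JNcell _ _)), Set.inter_comm]

theorem DiagBounded.sum_INcell_left {μ : Measure (ℝ × ℝ)} (h : DiagBounded μ) {N : ℕ} (hN : 0 < N)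
    (j : ℕ) : ∑ i ∈ Finset.range (2 * N), μ (INcell N (i + 1) j) = diagMinus μ (JNcell N j) := by
  set S : Set (ℝ × ℝ) := (fun p : ℝ × ℝ => p.2 - p.1) ⁻¹' JNcell N j with hS
  have hSm : MeasurableSet S := measurable_sub_coord (measurableSet_JNcell N j)
  have hr : DiagBounded (μ.restrict S) := h.mono Measure.restrict_le_self
  have := sum_measure_JNcell hr.map_add_le hr.diagPlus_compl hN
  rw [Measure.map_apply measurable_add_coord MeasurableSet.univ, Set.preimage_univ,
    Measure.restrict_apply MeasurableSet.univ, Set.univ_inter] at this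
  rw [diagMinus, Measure.map_apply measurable_sub_coord (measurableSet_JNcell N j), ← hS, ← this]
  refine Finset.sum_congr rfl fun i _ => ?_
  rw [INcell_eq, h.measure_inter_unitSq, Measure.map_apply measurable_add_coord
    (measurableSet_JNcell _ _), Measure.restrict_apply (measurable_add_coord
    (measurableSet_JNcell _ _))]

theorem DiagBounded.sum_INcell {μ : Measure (ℝ × ℝ)} (h : DiagBounded μ) {N : ℕ} (hN : 0 < N) :
    ∑ i ∈ Finset.range (2 * N), ∑ j ∈ Finset.range (2 * N), μ (INcell N (i + 1) (j + 1)) =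
      μ Set.univ := by
  simp only [h.sum_INcell_right hN]
  rw [sum_measure_JNcell (ν := diagPlus μ) h.map_add_le h.diagPlus_compl hN, diagPlus,
    Measure.map_apply measurable_add_coord MeasurableSet.univ, Set.preimage_univ]

theorem volume_restrict_JNcell {N i : ℕ} (hi : i < 2 * N) :
    volume.restrict (Set.Icc (-1 : ℝ) 1) (JNcell N (i + 1)) = ENNReal.ofReal (1 / N) := by
  have hN' : (0 : ℝ) < N := by exact_mod_cast (by omega : 0 < N)
  have hi' : (i : ℝ) + 1 ≤ 2 * N := by exact_mod_cast hi
  have hsub : JNcell N (i + 1) ⊆ Set.Icc (-1 : ℝ) 1 := by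
    intro x hx
    have h1 : 0 ≤ (i : ℝ) / N := by positivity
    have h2 : ((i : ℝ) + 1) / N ≤ 2 := by rw [div_le_iff₀ hN']; linarith
    simp only [JNcell, Nat.cast_add, Nat.cast_one, add_sub_cancel_right] at hx
    exact ⟨by linarith [hx.1], by linarith [hx.2]⟩
  rw [Measure.restrict_apply (measurableSet_JNcell _ _), Set.inter_eq_left.2 hsub, JNcell,
    Real.volume_Icc]
  congr 1
  push_cast
  field_simp
  ring

theorem bar_JNcell {ν : Measure ℝ} [IsFiniteMeasure ν] (hν : ν ≤ volume)
    (hs : ν (Set.Icc (-1) 1)ᶜ = 0) {N i : ℕ} (hi : i < 2 * N) :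
    ((volume.restrict (Set.Icc (-1 : ℝ) 1) - ν) (JNcell N (i + 1))).toReal =
      1 / N - (ν (JNcell N (i + 1))).toReal ∧ (ν (JNcell N (i + 1))).toReal ≤ 1 / N := by
  have hle : ν ≤ volume.restrict (Set.Icc (-1 : ℝ) 1) := by
    have : ν.restrict (Set.Icc (-1) 1) = ν :=
      Measure.restrict_eq_self_of_ae_mem (by rw [ae_iff]; exact hs)
    rw [← this]
    exact Measure.restrict_mono le_rfl hν
  have h1 := (hle (JNcell N (i + 1))).trans (volume_restrict_JNcell hi).le
  rw [Measure.sub_apply (measurableSet_JNcell _ _) hle, volume_restrict_JNcell hi,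
    ENNReal.toReal_sub_of_le h1 ENNReal.ofReal_ne_top, ENNReal.toReal_ofReal (by positivity)]
  refine ⟨rfl, ?_⟩
  have := ENNReal.toReal_mono ENNReal.ofReal_ne_top h1
  rwa [ENNReal.toReal_ofReal (by positivity)] at this

theorem volume_rotated_square (a b : ℝ) {h : ℝ} (hh : 0 ≤ h) :
    volume {p : ℝ × ℝ | p.1 + p.2 ∈ Set.Icc a (a + h) ∧ p.2 - p.1 ∈ Set.Icc b (b + h)} =
      ENNReal.ofReal (h ^ 2 / 2) := by
  set A : ℝ × ℝ →ₗ[ℝ] ℝ × ℝ :=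
    Matrix.toLin (Module.Basis.finTwoProd ℝ) (Module.Basis.finTwoProd ℝ) !![1, 1; -1, 1] with hA
  have hdet : LinearMap.det A = 2 := by
    rw [hA, LinearMap.det_toLin, Matrix.det_fin_two_of]; norm_num
  have e : {p : ℝ × ℝ | p.1 + p.2 ∈ Set.Icc a (a + h) ∧ p.2 - p.1 ∈ Set.Icc b (b + h)} =
      A ⁻¹' (Set.Icc a (a + h) ×ˢ Set.Icc b (b + h)) := by
    ext p
    rw [Set.mem_preimage, hA, Matrix.toLin_finTwoProd_apply, Set.mem_prod]
    simp only [Set.mem_ofPred_eq, one_mul, neg_mul, neg_add_eq_sub]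
  rw [e, Measure.addHaar_preimage_linearMap _ (by rw [hdet]; norm_num), hdet,
    Measure.volume_eq_prod, Measure.prod_prod,
    Real.volume_Icc, Real.volume_Icc, add_sub_cancel_left, add_sub_cancel_left,
    ← ENNReal.ofReal_mul hh, ← ENNReal.ofReal_mul (by positivity)]
  congr 1
  rw [abs_of_pos (by norm_num)]; ring

theorem volume_INcell_ne_top (N i j : ℕ) : volume (INcell N i j) ≠ ∞ := by
  refine ne_top_of_le_ne_top ?_ (measure_mono (fun p hp => hp.1 : INcell N i j ⊆ unitSq))
  exact (isCompact_Icc.prod isCompact_Icc).measure_ne_top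

theorem JNcell_succ (N i : ℕ) :
    JNcell N (i + 1) = Set.Icc (-1 + (i : ℝ) / N) (-1 + (i : ℝ) / N + 1 / N) := by
  simp only [JNcell]
  push_cast
  congr 1 <;> ring

/-- The half of an interval of the partition that is nearest to the origin. -/
theorem exists_half_JNcell {N : ℕ} (hN : 0 < N) (i : ℕ) :
    ∃ (a : ℝ) (k : ℕ), Set.Icc a (a + 1 / (2 * N)) ⊆ JNcell N (i + 1) ∧
      (∀ u ∈ Set.Icc a (a + 1 / (2 * N)), |u| ≤ k / N + 1 / (2 * N)) ∧
      ∀ u, -1 + (i : ℝ) / N < u → u < -1 + (i : ℝ) / N + 1 / N → (k : ℝ) / N < |u| := by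
  have hN' : (0 : ℝ) < N := by exact_mod_cast hN
  have hh : (1 : ℝ) / N = 1 / (2 * N) + 1 / (2 * N) := by field_simp; norm_num
  have hp : (0 : ℝ) < 1 / (2 * N) := by positivity
  rw [JNcell_succ]
  rcases le_or_gt N i with h | h
  · refine ⟨-1 + i / N, i - N, ?_, ?_, ?_⟩
    · exact Set.Icc_subset_Icc le_rfl (by linarith)
    all_goals rw [Nat.cast_sub h, sub_div, div_self hN'.ne']
    · rintro u ⟨h1, h2⟩
      have h3 : (1 : ℝ) ≤ i / N := by rw [le_div_iff₀ hN']; simpa using h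
      rw [abs_le]; constructor <;> linarith
    · intro u h1 _
      exact lt_of_lt_of_le (by linarith) (le_abs_self u)
  · refine ⟨-1 + i / N + 1 / (2 * N), N - (i + 1), ?_, ?_, ?_⟩
    · exact Set.Icc_subset_Icc (by linarith) (by linarith)
    all_goals rw [Nat.cast_sub h, sub_div, div_self hN'.ne']; push_cast; rw [add_div]
    · rintro u ⟨h1, h2⟩
      have h3 : (i : ℝ) / N + 1 / N ≤ 1 := by
        rw [← add_div, div_le_one hN']; exact_mod_cast h
      rw [abs_le]; constructor <;> linarith
    · intro u _ h2
      exact lt_of_lt_of_le (by linarith) (neg_le_abs u)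

theorem mem_unitSq_iff (p : ℝ × ℝ) : p ∈ unitSq ↔ |p.1 + p.2| + |p.2 - p.1| ≤ 1 := by
  simp only [unitSq, Set.mem_prod, Set.mem_Icc]
  constructor
  · rintro ⟨⟨h1, h2⟩, h3, h4⟩
    rcases abs_cases (p.1 + p.2) with h | h <;> rcases abs_cases (p.2 - p.1) with h' | h' <;>
      linarith
  · intro h
    have a1 := le_abs_self (p.1 + p.2)
    have a2 := neg_le_abs (p.1 + p.2)
    have a3 := le_abs_self (p.2 - p.1)
    have a4 := neg_le_abs (p.2 - p.1)
    refine ⟨⟨?_, ?_⟩, ?_, ?_⟩ <;> linarith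

theorem DiagBounded.measure_line_add {μ : Measure (ℝ × ℝ)} (h : DiagBounded μ) (c : ℝ) :
    μ {p | p.1 + p.2 = c} = 0 := by
  have h1 := h.map_add_le {c}
  rw [Measure.map_apply measurable_add_coord (measurableSet_singleton c)] at h1
  exact le_antisymm (h1.trans (by simp)) zero_le

theorem DiagBounded.measure_line_sub {μ : Measure (ℝ × ℝ)} (h : DiagBounded μ) (c : ℝ) :
    μ {p | p.2 - p.1 = c} = 0 := by
  have h1 := h.map_sub_le {c}
  rw [Measure.map_apply measurable_sub_coord (measurableSet_singleton c)] at h1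
  exact le_antisymm (h1.trans (by simp)) zero_le

theorem DiagBounded.le_volume_INcell {μ : Measure (ℝ × ℝ)} (h : DiagBounded μ) {N : ℕ} (hN : 0 < N)
    {i j : ℕ} (hz : μ (INcell N (i + 1) (j + 1)) ≠ 0) :
    1 / (8 * N ^ 2) ≤ (volume (INcell N (i + 1) (j + 1))).toReal := by
  have hN' : (0 : ℝ) < N := by exact_mod_cast hN
  obtain ⟨a, k, ha1, ha2, ha3⟩ := exists_half_JNcell hN i
  obtain ⟨b, l, hb1, hb2, hb3⟩ := exists_half_JNcell hN j
  have hkl : k + l + 1 ≤ N := by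
    by_contra hkl
    apply hz
    refine measure_mono_null (t := ({p | p.1 + p.2 = -1 + (i : ℝ) / N} ∪
      {p | p.1 + p.2 = -1 + (i : ℝ) / N + 1 / N}) ∪ ({p | p.2 - p.1 = -1 + (j : ℝ) / N} ∪
      {p | p.2 - p.1 = -1 + (j : ℝ) / N + 1 / N})) ?_ ?_
    · intro p hp
      rw [INcell_eq, JNcell_succ, JNcell_succ] at hp
      obtain ⟨hp0, hp1, hp2⟩ := hp
      simp only [Set.mem_union, Set.mem_ofPred_eq]
      by_contra! hne
      have u0 := ha3 (p.1 + p.2) (lt_of_le_of_ne hp1.1 (Ne.symm hne.1.1))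
        (lt_of_le_of_ne hp1.2 hne.1.2)
      have v0 := hb3 (p.2 - p.1) (lt_of_le_of_ne hp2.1 (Ne.symm hne.2.1))
        (lt_of_le_of_ne hp2.2 hne.2.2)
      have := (mem_unitSq_iff p).1 hp0
      have hlt : (k : ℝ) / N + l / N < 1 := by linarith
      rw [← add_div, div_lt_one hN'] at hlt
      have : k + l < N := by exact_mod_cast hlt
      omega
    · simp only [measure_union_null_iff, h.measure_line_add, h.measure_line_sub, and_self]
  have hkl' : (k : ℝ) / N + 1 / (2 * N) + (l / N + 1 / (2 * N)) ≤ 1 := by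
    have e : (k : ℝ) / N + 1 / (2 * N) + (l / N + 1 / (2 * N)) = (k + l + 1) / N := by
      field_simp; ring
    rw [e, div_le_one hN']
    exact_mod_cast hkl
  have hsub : {p : ℝ × ℝ | p.1 + p.2 ∈ Set.Icc a (a + 1 / (2 * N)) ∧
      p.2 - p.1 ∈ Set.Icc b (b + 1 / (2 * N))} ⊆ INcell N (i + 1) (j + 1) := by
    intro p hp
    refine ⟨(mem_unitSq_iff p).2 ?_, ha1 hp.1, hb1 hp.2⟩
    linarith [ha2 _ hp.1, hb2 _ hp.2]
  have := ENNReal.toReal_mono (volume_INcell_ne_top _ _ _) (measure_mono hsub)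
  rw [volume_rotated_square a b (by positivity), ENNReal.toReal_ofReal (by positivity)] at this
  refine le_trans (le_of_eq ?_) this
  field_simp; norm_num

/-- The part of the plane within distance `1/N` of the boundary of the square, or outside it. -/
def boundaryStrip (N : ℕ) : Set (ℝ × ℝ) :=
  {p | 1 / 2 - 1 / (N : ℝ) < |p.1| ∨ 1 / 2 - 1 / (N : ℝ) < |p.2|}

theorem measurableSet_boundaryStrip (N : ℕ) : MeasurableSet (boundaryStrip N) := by
  have h1 : MeasurableSet {p : ℝ × ℝ | 1 / 2 - 1 / (N : ℝ) < |p.1|} :=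
    measurableSet_lt (by fun_prop) (by fun_prop)
  have h2 : MeasurableSet {p : ℝ × ℝ | 1 / 2 - 1 / (N : ℝ) < |p.2|} :=
    measurableSet_lt (by fun_prop) (by fun_prop)
  exact h1.union h2

theorem volume_INcell_of_not_boundary {N : ℕ} (hN : 0 < N) {i j : ℕ}
    (hb : ¬ INcell N (i + 1) (j + 1) ⊆ boundaryStrip N) :
    (volume (INcell N (i + 1) (j + 1))).toReal = 1 / (2 * N ^ 2) := by
  obtain ⟨p, hp, hpb⟩ := Set.not_subset.1 hb
  simp only [boundaryStrip, Set.mem_ofPred_eq, not_or, not_lt] at hpb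
  have hN' : (0 : ℝ) < N := by exact_mod_cast hN
  rw [INcell_eq, JNcell_succ, JNcell_succ] at hp ⊢
  obtain ⟨-, hp1, hp2⟩ := hp
  rw [Set.inter_eq_right.2]
  · have := volume_rotated_square (-1 + (i : ℝ) / N) (-1 + (j : ℝ) / N) (h := 1 / N) (by positivity)
    have e : ((fun p : ℝ × ℝ => p.1 + p.2) ⁻¹'
          Set.Icc (-1 + (i : ℝ) / N) (-1 + (i : ℝ) / N + 1 / N) ∩
        (fun p => p.2 - p.1) ⁻¹' Set.Icc (-1 + (j : ℝ) / N) (-1 + (j : ℝ) / N + 1 / N)) =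
        {p : ℝ × ℝ | p.1 + p.2 ∈ Set.Icc (-1 + (i : ℝ) / N) (-1 + (i : ℝ) / N + 1 / N) ∧
          p.2 - p.1 ∈ Set.Icc (-1 + (j : ℝ) / N) (-1 + (j : ℝ) / N + 1 / N)} := rfl
    rw [e, this, ENNReal.toReal_ofReal (by positivity)]
    field_simp
  · rintro x ⟨⟨h1, h2⟩, h3, h4⟩
    obtain ⟨⟨g1, g2⟩, g3, g4⟩ := And.intro hp1 hp2
    have b1 := abs_le.1 hpb.1
    have b2 := abs_le.1 hpb.2
    simp only at h1 h2 h3 h4 g1 g2 g3 g4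
    refine ⟨⟨?_, ?_⟩, ?_, ?_⟩ <;> linarith

theorem queenon_boundaryStrip_le {γ : ProbabilityMeasure (ℝ × ℝ)} (hγ : γ ∈ queenons) (N : ℕ) :
    (γ.toMeasure (boundaryStrip N)).toReal ≤ 4 / N := by
  have hx := queenon_map_fst_le hγ
  have hy := queenon_map_snd_le hγ
  set h : ℝ := 1 / N with hh
  have h0 : 0 ≤ h := by positivity
  have ex : ∀ c : ℝ, γ.toMeasure (Prod.fst ⁻¹' Set.Icc c (c + h)) ≤ ENNReal.ofReal h := fun c => by
    have := hx (Set.Icc c (c + h))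
    rwa [Measure.map_apply measurable_fst measurableSet_Icc, Real.volume_Icc,
      add_sub_cancel_left] at this
  have ey : ∀ c : ℝ, γ.toMeasure (Prod.snd ⁻¹' Set.Icc c (c + h)) ≤ ENNReal.ofReal h := fun c => by
    have := hy (Set.Icc c (c + h))
    rwa [Measure.map_apply measurable_snd measurableSet_Icc, Real.volume_Icc,
      add_sub_cancel_left] at this
  have hsub : unitSq ∩ boundaryStrip N ⊆
      (Prod.fst ⁻¹' Set.Icc (1 / 2 - h) (1 / 2 - h + h) ∪
        Prod.fst ⁻¹' Set.Icc (-1 / 2) (-1 / 2 + h)) ∪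
      (Prod.snd ⁻¹' Set.Icc (1 / 2 - h) (1 / 2 - h + h) ∪
        Prod.snd ⁻¹' Set.Icc (-1 / 2) (-1 / 2 + h)) := by
    rintro p ⟨⟨⟨h1, h2⟩, h3, h4⟩, hb⟩
    simp only [Set.mem_union, Set.mem_preimage, Set.mem_Icc, sub_add_cancel]
    rcases hb with hb | hb
    · left
      rcases abs_cases p.1 with c | c
      · left; constructor <;> linarith
      · right; constructor <;> linarith
    · right
      rcases abs_cases p.2 with c | c
      · left; constructor <;> linarith
      · right; constructor <;> linarith
  have key : γ.toMeasure (boundaryStrip N) ≤ ENNReal.ofReal (4 * h) := by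
    rw [← (queenon_diagBounded hγ).measure_inter_unitSq]
    refine (measure_mono hsub).trans ((measure_union_le _ _).trans ((add_le_add
      (measure_union_le _ _) (measure_union_le _ _)).trans ((add_le_add (add_le_add (ex _) (ex _))
      (add_le_add (ey _) (ey _))).trans (le_of_eq ?_))))
    rw [← ENNReal.ofReal_add h0 h0, ← ENNReal.ofReal_add (by positivity) (by positivity)]
    congr 1; ring
  have := ENNReal.toReal_mono ENNReal.ofReal_ne_top key
  rw [ENNReal.toReal_ofReal (by positivity)] at this
  refine this.trans (le_of_eq ?_)
  rw [hh]; ring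

theorem sum_mul_log_two_mul {N : ℕ} (hN : 0 < N) {w : Fin (2 * N) → ℝ} (hw : ∑ s, w s = 1) :
    -∑ s, w s * Real.log (2 * N * w s) =
      ∑ s, (Real.negMulLog (w s) - Real.negMulLog (1 / N)) + Real.log N - Real.log 2 := by
  have hN' : (N : ℝ) ≠ 0 := by exact_mod_cast hN.ne'
  have h1 : ∀ s, w s * Real.log (2 * N * w s) =
      w s * (Real.log 2 + Real.log N) - Real.negMulLog (w s) := by
    intro s
    rcases eq_or_ne (w s) 0 with h | h
    · simp [h]
    · rw [Real.log_mul (by positivity) h, Real.log_mul two_ne_zero hN', Real.negMulLog]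
      ring
  simp only [h1, Finset.sum_sub_distrib, ← Finset.sum_mul, hw]
  simp only [Finset.sum_const, Finset.card_univ, Fintype.card_fin, nsmul_eq_mul, Real.negMulLog,
    one_div, Real.log_inv]
  push_cast
  field_simp
  ring

/-- The masses of the cells of the partition `I_N`, indexed from zero. -/
def cellMass (N : ℕ) (μ : Measure (ℝ × ℝ)) (a : Fin (2 * N) × Fin (2 * N)) : ℝ :=
  (μ (INcell N (a.1 + 1) (a.2 + 1))).toReal

section
variable {μ : Measure (ℝ × ℝ)} [IsFiniteMeasure μ] {N : ℕ}

theorem DiagBounded.sum_cellMass_right (h : DiagBounded μ) (hN : 0 < N) (s : Fin (2 * N)) :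
    ∑ t, cellMass N μ (s, t) = (diagPlus μ (JNcell N (s + 1))).toReal := by
  rw [← h.sum_INcell_right hN, ENNReal.toReal_sum fun _ _ => measure_ne_top _ _, Finset.sum_range]
  rfl

theorem DiagBounded.sum_cellMass_left (h : DiagBounded μ) (hN : 0 < N) (t : Fin (2 * N)) :
    ∑ s, cellMass N μ (s, t) = (diagMinus μ (JNcell N (t + 1))).toReal := by
  rw [← h.sum_INcell_left hN, ENNReal.toReal_sum fun _ _ => measure_ne_top _ _, Finset.sum_range]
  rfl

theorem DiagBounded.sum_cellMass (h : DiagBounded μ) (hN : 0 < N) :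
    ∑ a, cellMass N μ a = (μ Set.univ).toReal := by
  rw [Fintype.sum_prod_type, ← h.sum_INcell hN, ENNReal.toReal_sum fun _ _ =>
    ENNReal.sum_ne_top.2 fun _ _ => measure_ne_top _ _, Finset.sum_range]
  refine Finset.sum_congr rfl fun s _ => ?_
  rw [ENNReal.toReal_sum fun _ _ => measure_ne_top _ _, Finset.sum_range]
  rfl

theorem DiagBounded.barPlus_JNcell (h : DiagBounded μ) (s : Fin (2 * N)) :
    (barPlus μ (JNcell N (s + 1))).toReal = 1 / N - ∑ t, cellMass N μ (s, t) ∧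
      ∑ t, cellMass N μ (s, t) ≤ 1 / N := by
  have : IsFiniteMeasure (diagPlus μ) := by unfold diagPlus; infer_instance
  rw [h.sum_cellMass_right (by have := s.2; omega)]
  exact bar_JNcell h.map_add_le h.diagPlus_compl s.2

theorem DiagBounded.barMinus_JNcell (h : DiagBounded μ) (t : Fin (2 * N)) :
    (barMinus μ (JNcell N (t + 1))).toReal = 1 / N - ∑ s, cellMass N μ (s, t) ∧
      ∑ s, cellMass N μ (s, t) ≤ 1 / N := by
  have : IsFiniteMeasure (diagMinus μ) := by unfold diagMinus; infer_instance
  rw [h.sum_cellMass_left (by have := t.2; omega)]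
  exact bar_JNcell h.map_sub_le h.diagMinus_compl t.2

end

theorem DiagBounded.cellMass_mul_log_le {μ : Measure (ℝ × ℝ)} (h : DiagBounded μ) {N : ℕ}
    (hN : 0 < N) (a : Fin (2 * N) × Fin (2 * N)) :
    cellMass N μ a * Real.log (cellMass N μ a / (volume (INcell N (a.1 + 1) (a.2 + 1))).toReal) ≤
      cellMass N μ a * Real.log (2 * N ^ 2) - Real.negMulLog (cellMass N μ a) +
        2 * cellMass N (μ.restrict (boundaryStrip N)) a := by
  have hN' : (0 : ℝ) < N := by exact_mod_cast hN
  have hr : 0 ≤ cellMass N (μ.restrict (boundaryStrip N)) a := ENNReal.toReal_nonneg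
  have hz0 : 0 ≤ cellMass N μ a := ENNReal.toReal_nonneg
  rcases eq_or_ne (cellMass N μ a) 0 with h0 | h0
  · simpa [h0] using hr
  have hv := h.le_volume_INcell hN fun h' => h0 (by rw [cellMass, h', ENNReal.toReal_zero])
  by_cases hb : INcell N (a.1 + 1) (a.2 + 1) ⊆ boundaryStrip N
  · have e : cellMass N (μ.restrict (boundaryStrip N)) a = cellMass N μ a := by
      rw [cellMass, Measure.restrict_apply' (measurableSet_boundaryStrip N),
        Set.inter_eq_left.2 hb, cellMass]
    have hv0 : 0 < (volume (INcell N (a.1 + 1) (a.2 + 1))).toReal :=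
      lt_of_lt_of_le (by positivity) hv
    have hl := Real.log_le_log (by positivity) hv
    have h4 : Real.log 4 ≤ 2 := by
      rw [show (4 : ℝ) = 2 ^ 2 by norm_num, Real.log_pow]
      have := Real.log_two_lt_d9
      push_cast; linarith
    rw [show (1 : ℝ) / (8 * N ^ 2) = (4 * (2 * (N : ℝ) ^ 2))⁻¹ by field_simp; norm_num,
      Real.log_inv, Real.log_mul (by norm_num) (by positivity)] at hl
    rw [Real.log_div h0 hv0.ne', e, Real.negMulLog]
    nlinarith
  · rw [volume_INcell_of_not_boundary hN hb, div_div_eq_mul_div, div_one,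
      Real.log_mul h0 (by positivity), Real.negMulLog]
    linarith

theorem sum_Icc_one_eq_sum_fin (m : ℕ) (f : ℕ → ℝ) :
    ∑ i ∈ Finset.Icc 1 m, f i = ∑ i : Fin m, f (i + 1) := by
  rw [← Finset.sum_range fun i => f (i + 1), Finset.range_eq_Ico, Finset.sum_Ico_add' f 0 m 1]
  rfl

theorem queenon_blockEntropy_le {γ : ProbabilityMeasure (ℝ × ℝ)} (hγ : γ ∈ queenons) {N : ℕ}
    (hN : 0 < N) :
    blockEntropy (1 / (N : ℝ)) (cellMass N γ.toMeasure) ≤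
      HqN N γ.toMeasure + Real.log 2 + 3 + 8 / N := by
  have h := queenon_diagBounded hγ
  have hN' : (0 : ℝ) < N := by exact_mod_cast hN
  have htot : ∑ a, cellMass N γ.toMeasure a = 1 := by rw [h.sum_cellMass hN]; simp
  have hstrip : ∑ a, cellMass N (γ.toMeasure.restrict (boundaryStrip N)) a ≤ 4 / N := by
    rw [(h.mono Measure.restrict_le_self).sum_cellMass hN, Measure.restrict_apply_univ]
    exact queenon_boundaryStrip_le hγ N
  have hcells := Finset.sum_le_sum fun a (_ : a ∈ Finset.univ) =>
    h.cellMass_mul_log_le (μ := γ.toMeasure) hN a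
  rw [Finset.sum_add_distrib, Finset.sum_sub_distrib, ← Finset.sum_mul, ← Finset.mul_sum, htot,
    one_mul, Real.log_mul two_ne_zero (by positivity), Real.log_pow] at hcells
  have hplus : ∑ s : Fin (2 * N), (1 / (N : ℝ) - ∑ t, cellMass N γ.toMeasure (s, t)) = 1 := by
    rw [Finset.sum_sub_distrib, ← Fintype.sum_prod_type, htot]
    simp only [Finset.sum_const, Finset.card_univ, Fintype.card_fin, nsmul_eq_mul]
    push_cast; field_simp; norm_num
  have hminus : ∑ t : Fin (2 * N), (1 / (N : ℝ) - ∑ s, cellMass N γ.toMeasure (s, t)) = 1 := by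
    rw [Finset.sum_sub_distrib, ← Fintype.sum_prod_type_right, htot]
    simp only [Finset.sum_const, Finset.card_univ, Fintype.card_fin, nsmul_eq_mul]
    push_cast; field_simp; norm_num
  have hp := sum_mul_log_two_mul hN hplus
  have hm := sum_mul_log_two_mul hN hminus
  rw [HqN]
  simp only [sum_Icc_one_eq_sum_fin, (h.barPlus_JNcell _).1, (h.barMinus_JNcell _).1]
  rw [Fintype.sum_prod_type] at hcells
  simp only [cellMass] at hcells hp hm hstrip
  simp only [blockEntropy, cellMass]
  push_cast at hcells
  rw [show (8 : ℝ) / N = 2 * (4 / N) by ring]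
  linarith

theorem gammaOf_apply (n : ℕ) (q : Finset (ℕ × ℕ)) (S : Set (ℝ × ℝ)) :
    gammaOf n q S = n * volume (S ∩ ⋃ ij ∈ q, gridSq n ij.1 ij.2) := by
  have hm : MeasurableSet (⋃ ij ∈ q, gridSq n ij.1 ij.2) :=
    Finset.measurableSet_biUnion _ fun _ _ => measurableSet_Icc.prod measurableSet_Icc
  rw [gammaOf, withDensity_indicator hm, withDensity_const, Measure.smul_apply, smul_eq_mul,
    Measure.restrict_apply' hm]

theorem volume_gridSq {n : ℕ} (i j : ℕ) :
    volume (gridSq n i j) = ENNReal.ofReal (1 / n) * ENNReal.ofReal (1 / n) := by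
  rw [gridSq, Measure.volume_eq_prod, Measure.prod_prod, Real.volume_Icc, Real.volume_Icc]
  congr 2 <;> ring

theorem natCast_mul_ofReal_inv_sq {n : ℕ} (hn : 0 < n) (m : ℕ) :
    (n : ℝ≥0∞) * (m * (ENNReal.ofReal (1 / n) * ENNReal.ofReal (1 / n))) =
      ENNReal.ofReal (m / n) := by
  rw [← ENNReal.ofReal_natCast n, ← ENNReal.ofReal_natCast m,
    ← ENNReal.ofReal_mul (by positivity), ← ENNReal.ofReal_mul (by positivity),
    ← ENNReal.ofReal_mul (by positivity)]
  congr 1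
  have : (n : ℝ) ≠ 0 := by exact_mod_cast hn.ne'
  field_simp

theorem gammaOf_le_of_subset {n : ℕ} (hn : 0 < n) {q r : Finset (ℕ × ℕ)} {S : Set (ℝ × ℝ)}
    (hS : ∀ x ∈ q, ∀ p ∈ gridSq n x.1 x.2, p ∈ S → x ∈ r) :
    gammaOf n q S ≤ ENNReal.ofReal ((r.card : ℝ) / n) := by
  rw [gammaOf_apply, ← natCast_mul_ofReal_inv_sq hn]
  gcongr
  calc volume (S ∩ ⋃ ij ∈ q, gridSq n ij.1 ij.2) ≤ volume (⋃ ij ∈ r, gridSq n ij.1 ij.2) := by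
        refine measure_mono ?_
        rintro p ⟨hp, hq⟩
        simp only [Set.mem_iUnion, exists_prop] at hq ⊢
        obtain ⟨x, hx, hpx⟩ := hq
        exact ⟨x, hS x hx p hpx hp, hpx⟩
    _ ≤ ∑ ij ∈ r, volume (gridSq n ij.1 ij.2) := measure_biUnion_finset_le _ _
    _ = _ := by simp only [volume_gridSq, Finset.sum_const, nsmul_eq_mul]

theorem isFiniteMeasure_gammaOf {n : ℕ} (hn : 0 < n) (q : Finset (ℕ × ℕ)) :
    IsFiniteMeasure (gammaOf n q) :=
  ⟨(gammaOf_le_of_subset hn (r := q) fun _ hx _ _ _ => hx).trans_lt ENNReal.ofReal_lt_top⟩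

theorem le_gammaOf_of_subset {n : ℕ} (hn : 0 < n) {q r : Finset (ℕ × ℕ)} (hr : r ⊆ q)
    {S : Set (ℝ × ℝ)} (hS : ∀ x ∈ r, gridSq n x.1 x.2 ⊆ S) :
    ENNReal.ofReal ((r.card : ℝ) / n) ≤ gammaOf n q S := by
  have hn' : (0 : ℝ) < n := by exact_mod_cast hn
  set o : ℕ × ℕ → Set (ℝ × ℝ) := fun x =>
    Set.Ioo (-(1:ℝ)/2 + ((x.1:ℝ) - 1)/n) (-(1:ℝ)/2 + (x.1:ℝ)/n) ×ˢ
      Set.Ioo (-(1:ℝ)/2 + ((x.2:ℝ) - 1)/n) (-(1:ℝ)/2 + (x.2:ℝ)/n) with ho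
  have hsub : ∀ x, o x ⊆ gridSq n x.1 x.2 := fun x =>
    Set.prod_mono Set.Ioo_subset_Icc_self Set.Ioo_subset_Icc_self
  have hvol : ∀ x, volume (o x) = ENNReal.ofReal (1 / n) * ENNReal.ofReal (1 / n) := by
    intro x
    rw [ho, Measure.volume_eq_prod, Measure.prod_prod, Real.volume_Ioo, Real.volume_Ioo]
    congr 2 <;> ring
  have hone : ∀ {a b : ℕ} {u : ℝ},
      u ∈ Set.Ioo (-(1:ℝ)/2 + ((a:ℝ) - 1)/n) (-(1:ℝ)/2 + (a:ℝ)/n) →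
      u ∈ Set.Ioo (-(1:ℝ)/2 + ((b:ℝ) - 1)/n) (-(1:ℝ)/2 + (b:ℝ)/n) → a ≤ b := by
    rintro a b u ⟨h1, _⟩ ⟨_, h4⟩
    have : ((a : ℝ) - 1) / n < b / n := by linarith
    rw [div_lt_div_iff_of_pos_right hn', sub_lt_iff_lt_add] at this
    exact Nat.lt_succ_iff.1 (by exact_mod_cast this)
  have hdisj : ∀ x y, x ≠ y → Disjoint (o x) (o y) := by
    intro x y hxy
    rw [Set.disjoint_left]
    intro p hx hy
    exact hxy (Prod.ext (le_antisymm (hone hx.1 hy.1) (hone hy.1 hx.1))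
      (le_antisymm (hone hx.2 hy.2) (hone hy.2 hx.2)))
  rw [gammaOf_apply, ← natCast_mul_ofReal_inv_sq hn]
  gcongr
  calc (r.card : ℝ≥0∞) * (ENNReal.ofReal (1 / n) * ENNReal.ofReal (1 / n))
      = ∑ x ∈ r, volume (o x) := by simp only [hvol, Finset.sum_const, nsmul_eq_mul]
    _ = volume (⋃ x ∈ r, o x) := (measure_biUnion_finset (fun x _ y _ h => hdisj x y h)
        fun _ _ => measurableSet_Ioo.prod measurableSet_Ioo).symm
    _ ≤ _ := by
        refine measure_mono (Set.iUnion₂_subset fun x hx p hp => ⟨hS x hx (hsub x hp), ?_⟩)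
        exact Set.mem_biUnion (hr hx) (hsub x hp)

theorem abs_measureReal_Rset_sub_le_qdist {μ ν : Measure (ℝ × ℝ)} [IsFiniteMeasure μ]
    [IsFiniteMeasure ν] {a₁ b₁ a₂ b₂ : ℝ} (ha₁ : a₁ ∈ Set.Icc (-1 : ℝ) 1)
    (hb₁ : b₁ ∈ Set.Icc (-1 : ℝ) 1) (ha₂ : a₂ ∈ Set.Icc (-1 : ℝ) 1)
    (hb₂ : b₂ ∈ Set.Icc (-1 : ℝ) 1) :
    |μ.real (Rset a₁ b₁ a₂ b₂) - ν.real (Rset a₁ b₁ a₂ b₂)| ≤ qdist μ ν := by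
  refine le_csSup ⟨μ.real Set.univ + ν.real Set.univ, ?_⟩ ⟨a₁, b₁, a₂, b₂, ha₁, hb₁, ha₂, hb₂, rfl⟩
  rintro t ⟨a, b, c, d, -, -, -, -, rfl⟩
  have h1 : μ.real (Rset a b c d) ≤ _ := measureReal_mono (Set.subset_univ _)
  have h2 : ν.real (Rset a b c d) ≤ _ := measureReal_mono (Set.subset_univ _)
  have h3 : 0 ≤ μ.real (Rset a b c d) := measureReal_nonneg
  have h4 : 0 ≤ ν.real (Rset a b c d) := measureReal_nonneg
  simp only [Measure.real] at *
  rw [abs_le]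
  constructor <;> linarith

theorem DiagBounded.measureReal_strip_add_le {μ : Measure (ℝ × ℝ)} (h : DiagBounded μ) (c : ℝ)
    {w : ℝ} (hw : 0 ≤ w) : μ.real {p | p.1 + p.2 ∈ Set.Icc c (c + w)} ≤ w := by
  have h1 := h.map_add_le (Set.Icc c (c + w))
  rw [Measure.map_apply measurable_add_coord measurableSet_Icc, Real.volume_Icc,
    add_sub_cancel_left] at h1
  exact ENNReal.toReal_le_of_le_ofReal hw h1

theorem DiagBounded.measureReal_strip_sub_le {μ : Measure (ℝ × ℝ)} (h : DiagBounded μ) (c : ℝ)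
    {w : ℝ} (hw : 0 ≤ w) : μ.real {p | p.2 - p.1 ∈ Set.Icc c (c + w)} ≤ w := by
  have h1 := h.map_sub_le (Set.Icc c (c + w))
  rw [Measure.map_apply measurable_sub_coord measurableSet_Icc, Real.volume_Icc,
    add_sub_cancel_left] at h1
  exact ENNReal.toReal_le_of_le_ofReal hw h1

/-- Enlarging a diagonal rectangle by `w` at each end increases its mass by at most `4 * w`. -/
theorem DiagBounded.measureReal_Rset_le {μ : Measure (ℝ × ℝ)} [IsFiniteMeasure μ]
    (h : DiagBounded μ) {w : ℝ} (hw : 0 ≤ w) {a₁ b₁ a₂ b₂ a₁' b₁' a₂' b₂' : ℝ} (ha₁ : a₁' - w ≤ a₁)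
    (hb₁ : b₁ ≤ b₁' + w) (ha₂ : a₂' - w ≤ a₂) (hb₂ : b₂ ≤ b₂' + w) :
    μ.real (Rset a₁ b₁ a₂ b₂) ≤ μ.real (Rset a₁' b₁' a₂' b₂') + 4 * w := by
  have hsub : Rset a₁ b₁ a₂ b₂ ⊆ Rset a₁' b₁' a₂' b₂' ∪
      (({p | p.1 + p.2 ∈ Set.Icc (a₁' - w) (a₁' - w + w)} ∪
        {p | p.1 + p.2 ∈ Set.Icc b₁' (b₁' + w)}) ∪
      ({p | p.2 - p.1 ∈ Set.Icc (a₂' - w) (a₂' - w + w)} ∪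
        {p | p.2 - p.1 ∈ Set.Icc b₂' (b₂' + w)})) := by
    rintro p ⟨hp, ⟨h1, h2⟩, h3, h4⟩
    by_contra hcon
    simp only [Set.mem_union, Set.mem_ofPred_eq, Set.mem_Icc, not_or, not_and, not_le,
      sub_add_cancel] at hcon
    obtain ⟨c0, ⟨c1, c2⟩, c3, c4⟩ := hcon
    refine c0 ⟨hp, ⟨?_, ?_⟩, ?_, ?_⟩
    · exact (c1 (by linarith)).le
    · by_contra! hc; linarith [c2 hc.le]
    · exact (c3 (by linarith)).le
    · by_contra! hc; linarith [c4 hc.le]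
  refine (measureReal_mono hsub).trans ((measureReal_union_le _ _).trans ?_)
  have h1 := measureReal_union_le (μ := μ) ({p | p.1 + p.2 ∈ Set.Icc (a₁' - w) (a₁' - w + w)} ∪
        {p | p.1 + p.2 ∈ Set.Icc b₁' (b₁' + w)})
      ({p | p.2 - p.1 ∈ Set.Icc (a₂' - w) (a₂' - w + w)} ∪
        {p | p.2 - p.1 ∈ Set.Icc b₂' (b₂' + w)})
  have h2 := measureReal_union_le (μ := μ) {p | p.1 + p.2 ∈ Set.Icc (a₁' - w) (a₁' - w + w)}
        {p | p.1 + p.2 ∈ Set.Icc b₁' (b₁' + w)}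
  have h3 := measureReal_union_le (μ := μ) {p | p.2 - p.1 ∈ Set.Icc (a₂' - w) (a₂' - w + w)}
        {p | p.2 - p.1 ∈ Set.Icc b₂' (b₂' + w)}
  linarith [h.measureReal_strip_add_le (a₁' - w) hw, h.measureReal_strip_add_le b₁' hw,
    h.measureReal_strip_sub_le (a₂' - w) hw, h.measureReal_strip_sub_le b₂' hw]

theorem mem_gridSq_diag {n : ℕ} (hn : 0 < n) {i j : ℕ} (hi : i ∈ Finset.Icc 1 n)
    (hj : j ∈ Finset.Icc 1 n) {p : ℝ × ℝ} (hp : p ∈ gridSq n i j) :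
    p ∈ unitSq ∧
    p.1 + p.2 ∈ Set.Icc (-1 + (plusIdx (i, j) : ℝ) / n - 1 / n)
      (-1 + (plusIdx (i, j) : ℝ) / n + 1 / n) ∧
    p.2 - p.1 ∈ Set.Icc (-1 + (minusIdx n (i, j) : ℝ) / n - 1 / n)
      (-1 + (minusIdx n (i, j) : ℝ) / n + 1 / n) := by
  have hn' : (0 : ℝ) < n := by exact_mod_cast hn
  rw [Finset.mem_Icc] at hi hj
  obtain ⟨⟨h1, h2⟩, h3, h4⟩ := hp
  have e1 : (plusIdx (i, j) : ℝ) / n = i / n + j / n - 1 / n := by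
    rw [plusIdx, Nat.cast_sub (by simp only; omega)]; push_cast; ring
  have e2 : (minusIdx n (i, j) : ℝ) / n = 1 + j / n - i / n := by
    rw [minusIdx, Nat.cast_sub (by simp only; omega)]; push_cast; field_simp
  rw [sub_div] at h1 h3
  have i1 : 1 / (n : ℝ) ≤ i / n := by gcongr; exact_mod_cast hi.1
  have j1 : 1 / (n : ℝ) ≤ j / n := by gcongr; exact_mod_cast hj.1
  have i2 : (i : ℝ) / n ≤ 1 := by rw [div_le_one hn']; exact_mod_cast hi.2
  have j2 : (j : ℝ) / n ≤ 1 := by rw [div_le_one hn']; exact_mod_cast hj.2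
  rw [e1, e2]
  refine ⟨⟨⟨?_, ?_⟩, ?_, ?_⟩, ⟨?_, ?_⟩, ?_, ?_⟩ <;> linarith

theorem div_eq_iff_real {N n : ℕ} (hN : 0 < N) (hn : 0 < n) {k s : ℕ} :
    N * k / n = s ↔ (s : ℝ) / N ≤ k / n ∧ (k : ℝ) / n < s / N + 1 / N := by
  have hN' : (0 : ℝ) < N := by exact_mod_cast hN
  have hn' : (0 : ℝ) < n := by exact_mod_cast hn
  rw [Nat.div_eq_iff hn, ← add_div, div_le_div_iff₀ hN' hn', div_lt_div_iff₀ hn' hN']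
  have : N * k ≤ s * n + n - 1 ↔ k * N < (s + 1) * n := by
    rw [add_mul, mul_comm k N]; omega
  rw [this, mul_comm N k]
  norm_cast

theorem abs_cellCount_sub_cellMass_le {γ : Measure (ℝ × ℝ)} [IsFiniteMeasure γ]
    (hγ : DiagBounded γ) {N n : ℕ} (hN : 0 < N) (hn : 2 * N ≤ n) {ε : ℝ} (hε : 0 < ε)
    (hnε : 8 / ε ≤ n) {q : Finset (ℕ × ℕ)} (hq : q ∈ Bset n γ ε) (s t : Fin (2 * N)) :
    |(cellCount N n q s t : ℝ) / n - cellMass N γ (s, t)| ≤ 2 * ε := by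
  have hn0 : 0 < n := by omega
  have hN' : (0 : ℝ) < N := by exact_mod_cast hN
  have hn' : (0 : ℝ) < n := by exact_mod_cast hn0
  have := isFiniteMeasure_gammaOf hn0 q
  set w : ℝ := 1 / n with hwdef
  have hw : 0 < w := by positivity
  have hwε : 8 * w ≤ ε := by
    rw [div_le_iff₀ hε] at hnε
    rw [hwdef, mul_one_div, div_le_iff₀ hn']; linarith
  have hwN : 2 * w ≤ 1 / N := by
    rw [hwdef, mul_one_div, div_le_div_iff₀ hn' hN']; exact_mod_cast (by omega)
  have idx : ∀ i : Fin (2 * N), 0 ≤ (i : ℝ) / N ∧ (i : ℝ) / N + 1 / N ≤ 2 := fun i => by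
    refine ⟨by positivity, ?_⟩
    rw [← add_div, div_le_iff₀ hN']; exact_mod_cast i.2
  obtain ⟨s0, s1⟩ := idx s
  obtain ⟨t0, t1⟩ := idx t
  set r := q.filter fun x => N * plusIdx x / n = s ∧ N * minusIdx n x / n = t with hr
  have hcount : (cellCount N n q s t : ℝ) = r.card := rfl
  have hcell : cellMass N γ (s, t) = γ.real (Rset (-1 + s / N) (-1 + s / N + 1 / N)
      (-1 + t / N) (-1 + t / N + 1 / N)) := by
    rw [cellMass, INcell_eq, JNcell_succ, JNcell_succ]
    rfl
  have hmem : ∀ x ∈ r, x ∈ q ∧ ((s : ℝ) / N ≤ plusIdx x / n ∧ (plusIdx x : ℝ) / n < s / N + 1 / N) ∧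
      ((t : ℝ) / N ≤ minusIdx n x / n ∧ (minusIdx n x : ℝ) / n < t / N + 1 / N) := by
    intro x hx
    rw [hr, Finset.mem_filter] at hx
    exact ⟨hx.1, (div_eq_iff_real hN hn0).1 hx.2.1, (div_eq_iff_real hN hn0).1 hx.2.2⟩
  rw [hcount, abs_le]
  constructor
  · have h1 : (gammaOf n q).real (Rset (-1 + s / N + w) (-1 + s / N + 1 / N - 2 * w)
        (-1 + t / N + w) (-1 + t / N + 1 / N - 2 * w)) ≤ r.card / n := by
      refine ENNReal.toReal_le_of_le_ofReal (by positivity) (gammaOf_le_of_subset hn0 ?_)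
      intro x hx p hp hpR
      have hb := hq.1.1 x hx
      obtain ⟨-, ⟨u1, u2⟩, v1, v2⟩ := mem_gridSq_diag hn0 hb.1 hb.2 hp
      obtain ⟨-, ⟨c1, c2⟩, c3, c4⟩ := hpR
      rw [hr, Finset.mem_filter, div_eq_iff_real hN hn0, div_eq_iff_real hN hn0]
      refine ⟨hx, ⟨?_, ?_⟩, ?_, ?_⟩ <;> linarith
    have h2 := (abs_le.1 (abs_measureReal_Rset_sub_le_qdist (μ := gammaOf n q) (ν := γ)
      (a₁ := -1 + s / N + w) (b₁ := -1 + s / N + 1 / N - 2 * w)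
      (a₂ := -1 + t / N + w) (b₂ := -1 + t / N + 1 / N - 2 * w)
      ⟨by linarith, by linarith⟩ ⟨by linarith, by linarith⟩ ⟨by linarith, by linarith⟩
      ⟨by linarith, by linarith⟩)).1
    have h3 := hγ.measureReal_Rset_le (w := 2 * w) (by positivity)
      (a₁ := -1 + s / N) (b₁ := -1 + s / N + 1 / N) (a₂ := -1 + t / N) (b₂ := -1 + t / N + 1 / N)
      (a₁' := -1 + s / N + w) (b₁' := -1 + s / N + 1 / N - 2 * w)
      (a₂' := -1 + t / N + w) (b₂' := -1 + t / N + 1 / N - 2 * w)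
      (by linarith) (by linarith) (by linarith) (by linarith)
    linarith [hq.2]
  · set a₁ := max (-1) (-1 + (s : ℝ) / N - w) with ha₁
    set b₁ := min 1 (-1 + (s : ℝ) / N + 1 / N + w) with hb₁
    set a₂ := max (-1) (-1 + (t : ℝ) / N - w) with ha₂
    set b₂ := min 1 (-1 + (t : ℝ) / N + 1 / N + w) with hb₂
    have h1 : r.card / n ≤ (gammaOf n q).real (Rset a₁ b₁ a₂ b₂) := by
      refine (ENNReal.ofReal_le_iff_le_toReal (measure_ne_top _ _)).1
        (le_gammaOf_of_subset hn0 (Finset.filter_subset _ _) ?_)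
      intro x hx p hp
      obtain ⟨hxq, ⟨c1, c2⟩, c3, c4⟩ := hmem x hx
      have hb := hq.1.1 x hxq
      obtain ⟨hu, ⟨u1, u2⟩, v1, v2⟩ := mem_gridSq_diag hn0 hb.1 hb.2 hp
      have hu' := hu
      obtain ⟨⟨d1, d2⟩, d3, d4⟩ := hu'
      refine ⟨hu, ⟨max_le ?_ ?_, le_min ?_ ?_⟩, max_le ?_ ?_, le_min ?_ ?_⟩ <;> linarith
    have h2 := (abs_le.1 (abs_measureReal_Rset_sub_le_qdist (μ := gammaOf n q) (ν := γ)
      (a₁ := a₁) (b₁ := b₁) (a₂ := a₂) (b₂ := b₂)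
      ⟨le_max_left _ _, max_le (by norm_num) (by linarith)⟩
      ⟨le_min (by norm_num) (by linarith), min_le_left _ _⟩
      ⟨le_max_left _ _, max_le (by norm_num) (by linarith)⟩
      ⟨le_min (by norm_num) (by linarith), min_le_left _ _⟩)).2
    have h3 := hγ.measureReal_Rset_le (w := w) hw.le
      (a₁ := a₁) (b₁ := b₁) (a₂ := a₂) (b₂ := b₂)
      (a₁' := -1 + s / N) (b₁' := -1 + s / N + 1 / N) (a₂' := -1 + t / N)
      (b₂' := -1 + t / N + 1 / N) (le_max_right _ _) (min_le_right _ _) (le_max_right _ _)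
      (min_le_right _ _)
    linarith [hq.2]

theorem finite_Bset (n : ℕ) (γ : Measure (ℝ × ℝ)) (ε : ℝ) : (Bset n γ ε).Finite := by
  refine (Finset.finite_toSet (board n).powerset).subset fun q hq => ?_
  rw [Finset.mem_coe, Finset.mem_powerset]
  exact fun x hx => Finset.mem_product.2 (hq.1.1 x hx)

theorem eventually_log_terms_le {ε K C : ℝ} (hε : 0 < ε) (hK : 0 < K) :
    ∀ᶠ n : ℕ in atTop, K * Real.log (n + 1) + C ≤ n * ε := by
  have h1 := (Real.isLittleO_log_id_atTop.bound (show 0 < ε / (4 * K) by positivity))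
  have h2 : Tendsto (fun n : ℕ => (n : ℝ) + 1) atTop atTop :=
    tendsto_atTop_add_const_right _ _ tendsto_natCast_atTop_atTop
  filter_upwards [h2.eventually h1, eventually_ge_atTop 1,
    tendsto_natCast_atTop_atTop.eventually_ge_atTop (2 * C / ε)] with n hn h1n hC
  rw [div_le_iff₀ hε] at hC
  have hn1 : (1 : ℝ) ≤ n := by exact_mod_cast h1n
  rw [id, Real.norm_of_nonneg (by positivity : (0 : ℝ) ≤ n + 1)] at hn
  have h3 : Real.log (n + 1) ≤ ε / (4 * K) * (n + 1) := (le_abs_self _).trans hn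
  have h4 : K * Real.log (n + 1) ≤ K * (ε / (4 * K) * (n + 1)) := by gcongr
  have h5 : K * (ε / (4 * K) * (n + 1)) = ε / 4 * (n + 1) := by field_simp
  nlinarith

theorem eventually_Bcard_le {γ : ProbabilityMeasure (ℝ × ℝ)} (hγ : γ ∈ queenons) {N : ℕ}
    (hN : 2 ≤ N) {ε : ℝ} (hε : 0 < ε) (hε' : ε ≤ 1 / 2) :
    ∀ᶠ n : ℕ in atTop, (Bcard n γ.toMeasure ε : ℝ) ≤ Real.exp (n * (Real.log n +
      (HqN N γ.toMeasure + 8 / N + 200 * N ^ 2 * ε ^ (3 / 4 : ℝ) + ε))) := by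
  have hb := queenon_diagBounded hγ
  set c : ℕ := ⌈2 * N / (ε / 2) ^ 2⌉₊ with hc
  have hc' : 2 * (N : ℝ) ≤ c * (ε / 2) ^ 2 := by
    rw [← div_le_iff₀ (by positivity)]; exact Nat.le_ceil _
  filter_upwards [eventually_log_terms_le (K := (4 * N) ^ 2 + 1 + c) (C := 1 + c + 4 / ε) hε
    (by positivity), eventually_ge_atTop (2 * N),
    tendsto_natCast_atTop_atTop.eventually_ge_atTop (8 / ε)] with n hlog hnN hnε
  have hfin := finite_Bset n γ.toMeasure ε
  have hcard : Bcard n γ.toMeasure ε = hfin.toFinset.card := Set.ncard_eq_toFinset_card _ hfin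
  have hmain := card_queens_close_le hN hε hε' hc' hnε (z := cellMass N γ.toMeasure)
    (fun a => (ENNReal.toReal_nonneg : 0 ≤ cellMass N γ.toMeasure a))
    (fun s => (hb.barPlus_JNcell s).2) (fun t => (hb.barMinus_JNcell t).2) (B := hfin.toFinset)
    fun q hq => ⟨((Set.Finite.mem_toFinset _).1 hq).1, fun s t =>
      abs_cellCount_sub_cellMass_le hb (by omega) hnN hε hnε ((Set.Finite.mem_toFinset _).1 hq) s t⟩
  rw [hcard]
  refine hmain.trans (Real.exp_le_exp.2 ?_)
  have hent := queenon_blockEntropy_le hγ (show 0 < N by omega)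
  have hn1 : (0 : ℝ) < n := by exact_mod_cast (by omega)
  have hl : Real.log n ≤ Real.log (n + 1) := Real.log_le_log hn1 (by linarith)
  have h1 : (n : ℝ) * (Real.log n - 3 - Real.log 2 + blockEntropy (1 / N) (cellMass N γ.toMeasure) +
      200 * N ^ 2 * ε ^ (3 / 4 : ℝ)) ≤ n * (Real.log n + (HqN N γ.toMeasure + 8 / N +
      200 * N ^ 2 * ε ^ (3 / 4 : ℝ))) := by
    gcongr ?_ * ?_
    linarith
  have h2 : (c : ℝ) * Real.log n ≤ c * Real.log (n + 1) := by gcongr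
  linarith

/-- The accumulated errors are absorbed by `ε ^ (1/200)` when `ε` is small. -/
theorem error_le_rpow {ε : ℝ} (hε : 0 < ε) (hε' : ε ≤ (1 / 1000 : ℝ) ^ (600 / 47 : ℝ)) :
    2 ≤ ⌈ε ^ (-(1 : ℝ) / 3)⌉₊ ∧ ε ≤ 1 / 2 ∧
    8 / (⌈ε ^ (-(1 : ℝ) / 3)⌉₊ : ℝ) + 200 * (⌈ε ^ (-(1 : ℝ) / 3)⌉₊ : ℝ) ^ 2 * ε ^ (3 / 4 : ℝ) + ε ≤
      ε ^ ((1 : ℝ) / 200) := by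
  have hsmall : ε ≤ 1 / 1000 := by
    refine hε'.trans ((Real.rpow_le_rpow_of_exponent_ge (by norm_num) (by norm_num)
      (show (1 : ℝ) ≤ 600 / 47 by norm_num)).trans (by rw [Real.rpow_one]))
  have h1 : ε ≤ 1 := by linarith
  set X := ε ^ (-(1 : ℝ) / 3) with hX
  have hX1 : 1 < X := Real.one_lt_rpow_of_pos_of_lt_one_of_neg hε (by linarith) (by norm_num)
  have hN2 : 2 ≤ ⌈X⌉₊ := Nat.lt_ceil.2 (by simpa using hX1)
  refine ⟨hN2, by linarith, ?_⟩
  have hNX : X ≤ ⌈X⌉₊ := Nat.le_ceil _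
  have hNX' : (⌈X⌉₊ : ℝ) ≤ 2 * X := by linarith [Nat.ceil_lt_add_one (zero_le_one.trans hX1.le)]
  set δ := ε ^ (1 / 12 : ℝ) with hδ
  have e1 : 8 / (⌈X⌉₊ : ℝ) ≤ 8 * δ := by
    calc 8 / (⌈X⌉₊ : ℝ) ≤ 8 / X := by gcongr
      _ = 8 * ε ^ (1 / 3 : ℝ) := by
        rw [hX, neg_div, Real.rpow_neg hε.le, div_inv_eq_mul]
      _ ≤ 8 * δ := by
        gcongr 8 * ?_
        exact Real.rpow_le_rpow_of_exponent_ge hε h1 (by norm_num)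
  have e2 : 200 * (⌈X⌉₊ : ℝ) ^ 2 * ε ^ (3 / 4 : ℝ) ≤ 800 * δ := by
    calc 200 * (⌈X⌉₊ : ℝ) ^ 2 * ε ^ (3 / 4 : ℝ) ≤ 200 * (2 * X) ^ 2 * ε ^ (3 / 4 : ℝ) := by gcongr
      _ = 800 * (X * X * ε ^ (3 / 4 : ℝ)) := by ring
      _ = 800 * δ := by
        rw [hX, ← Real.rpow_add hε, ← Real.rpow_add hε, hδ]; norm_num
  have e3 : ε ≤ δ := by
    calc ε = ε ^ (1 : ℝ) := (Real.rpow_one ε).symm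
      _ ≤ δ := Real.rpow_le_rpow_of_exponent_ge hε h1 (by norm_num)
  have e4 : δ = ε ^ ((1 : ℝ) / 200) * ε ^ (47 / 600 : ℝ) := by
    rw [hδ, ← Real.rpow_add hε]; norm_num
  have e5 : ε ^ (47 / 600 : ℝ) ≤ 1 / 1000 := by
    refine (Real.rpow_le_rpow hε.le hε' (by norm_num)).trans (le_of_eq ?_)
    rw [← Real.rpow_mul (by norm_num)]; norm_num
  have e6 : δ ≤ ε ^ ((1 : ℝ) / 200) * (1 / 1000) := by rw [e4]; gcongr
  have e7 : 0 ≤ ε ^ ((1 : ℝ) / 200) := by positivity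
  linarith

/-- **Theorem (enumeration, upper bound).**
For a queenon `γ` and all sufficiently small `ε > 0` there is an `N ∈ ℕ` with
`N ≥ ε^{-1/3}` such that `limsup_n |B_n(γ,ε)|^{1/n}/n ≤ exp(H_q^N(γ) + ε^{1/200})`. -/
theorem enumeration_upper_bound (γ : ProbabilityMeasure (ℝ × ℝ)) (hγ : γ ∈ queenons) :
    ∃ ε₀ : ℝ, 0 < ε₀ ∧ ∀ ε : ℝ, 0 < ε → ε ≤ ε₀ →
      ∃ N : ℕ, ε ^ (-(1:ℝ)/3) ≤ (N : ℝ) ∧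
        limsup (fun n : ℕ => (Bcard n γ.toMeasure ε : ℝ) ^ (1/(n:ℝ)) / (n : ℝ)) atTop
          ≤ Real.exp (HqN N γ.toMeasure + ε ^ ((1:ℝ)/200)) := by
  refine ⟨(1 / 1000 : ℝ) ^ (600 / 47 : ℝ), by positivity, fun ε hε hε' => ?_⟩
  obtain ⟨hN, hε₂, herr⟩ := error_le_rpow hε hε'
  refine ⟨⌈ε ^ (-(1 : ℝ) / 3)⌉₊, Nat.le_ceil _, ?_⟩
  refine limsup_le_of_le (isCoboundedUnder_le_of_le atTop (x := 0) fun n => by positivity) ?_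
  filter_upwards [eventually_Bcard_le hγ hN hε hε₂, eventually_gt_atTop 0] with n hn hn0
  have hn' : (0 : ℝ) < n := by exact_mod_cast hn0
  rw [div_le_iff₀ hn']
  refine (Real.rpow_le_rpow (by positivity) hn (by positivity)).trans ?_
  rw [← Real.exp_mul, mul_one_div, mul_div_cancel_left₀ _ hn'.ne', Real.exp_add, Real.exp_log hn',
    mul_comm]
  gcongr ?_ * _
  exact Real.exp_le_exp.2 (by linarith)

end
end

section
/- Let α ∈ R and N ∈ ℕ. There exists a subset X of I_N such that α ⊆ ∪_{β∈X} β and (∪_{β∈X} β) \ α is contained in the union of four diagonal strips, each of width 2/N (a diagonal strip of width w being a set of the form {(x,y) : a ≤ x+y ≤ a+w} or {(x,y) : a ≤ y−x ≤ a+w}). -/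
open MeasureTheory Filter Topology
open scoped ENNReal

noncomputable section

/-- The diagonal strip `{(x,y) : a ≤ x+y ≤ a+w}`. -/
def DiagStripPlus (a w : ℝ) : Set (ℝ × ℝ) := {p | a ≤ p.1 + p.2 ∧ p.1 + p.2 ≤ a + w}

/-- The diagonal strip `{(x,y) : a ≤ y−x ≤ a+w}`. -/
def DiagStripMinus (a w : ℝ) : Set (ℝ × ℝ) := {p | a ≤ p.2 - p.1 ∧ p.2 - p.1 ≤ a + w}

/-- A diagonal strip of width `w`. -/
def IsDiagStrip (w : ℝ) (s : Set (ℝ × ℝ)) : Prop :=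
  ∃ a : ℝ, s = DiagStripPlus a w ∨ s = DiagStripMinus a w

/-- Every point of `[-1,1]` lies in one of the `2N` intervals of the partition `J_N`. -/
theorem exists_mem_JNcell {N : ℕ} (hN : 0 < N) {s : ℝ} (hs : s ∈ Set.Icc (-1 : ℝ) 1) :
    ∃ i ∈ Finset.Icc 1 (2 * N), s ∈ JNcell N i := by
  have hN' : (0 : ℝ) < N := Nat.cast_pos.mpr hN
  rcases hs.1.eq_or_lt with rfl | hlt
  · refine ⟨1, Finset.mem_Icc.mpr ⟨le_rfl, by lia⟩, by simp, ?_⟩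
    simp
  · have hpos : 0 < (s + 1) * N := mul_pos (by linarith) hN'
    refine ⟨⌈(s + 1) * N⌉₊, Finset.mem_Icc.mpr ⟨Nat.ceil_pos.mpr hpos, ?_⟩, ?_, ?_⟩
    · refine Nat.ceil_le.mpr ?_
      push_cast
      exact mul_le_mul_of_nonneg_right (by linarith [hs.2]) hN'.le
    · have h : ((⌈(s + 1) * N⌉₊ : ℝ) - 1) / N ≤ s + 1 :=
        (div_le_iff₀ hN').mpr (by linarith [Nat.ceil_lt_add_one hpos.le])
      linarith
    · have h : s + 1 ≤ (⌈(s + 1) * N⌉₊ : ℝ) / N := (le_div_iff₀ hN').mpr (Nat.le_ceil _)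
      linarith

/-- Every point of the square lies in one of the cells of the partition `I_N`. -/
theorem exists_mem_INcell {N : ℕ} (hN : 0 < N) {p : ℝ × ℝ} (hp : p ∈ unitSq) :
    ∃ ij ∈ Finset.Icc 1 (2 * N) ×ˢ Finset.Icc 1 (2 * N), p ∈ INcell N ij.1 ij.2 := by
  have ⟨⟨hx, hx'⟩, hy, hy'⟩ := hp
  obtain ⟨i, hi, hpi⟩ := exists_mem_JNcell hN (s := p.1 + p.2) ⟨by linarith, by linarith⟩
  obtain ⟨j, hj, hpj⟩ := exists_mem_JNcell hN (s := p.2 - p.1) ⟨by linarith, by linarith⟩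
  exact ⟨(i, j), Finset.mk_mem_product hi hj, hp, hpi, hpj⟩

/-- **Lemma (covering lemma).**
For `α ∈ R` and `N ∈ ℕ` there is a set `X ⊆ I_N` with `α ⊆ ⋃_{β ∈ X} β` and
`(⋃_{β ∈ X} β) \ α` contained in four diagonal strips, each of width `2/N`. -/
theorem covering_lemma (N : ℕ) (hN : 0 < N) (a₁ b₁ a₂ b₂ : ℝ)
    (ha₁ : a₁ ∈ Set.Icc (-1:ℝ) 1) (hb₁ : b₁ ∈ Set.Icc (-1:ℝ) 1)
    (ha₂ : a₂ ∈ Set.Icc (-1:ℝ) 1) (hb₂ : b₂ ∈ Set.Icc (-1:ℝ) 1) :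
    ∃ X : Finset (ℕ × ℕ), X ⊆ Finset.Icc 1 (2*N) ×ˢ Finset.Icc 1 (2*N) ∧
      Rset a₁ b₁ a₂ b₂ ⊆ (⋃ ij ∈ X, INcell N ij.1 ij.2) ∧
      ∃ s₁ s₂ s₃ s₄ : Set (ℝ × ℝ),
        IsDiagStrip (2/(N:ℝ)) s₁ ∧ IsDiagStrip (2/(N:ℝ)) s₂ ∧
        IsDiagStrip (2/(N:ℝ)) s₃ ∧ IsDiagStrip (2/(N:ℝ)) s₄ ∧
        (⋃ ij ∈ X, INcell N ij.1 ij.2) \ Rset a₁ b₁ a₂ b₂ ⊆ s₁ ∪ s₂ ∪ s₃ ∪ s₄ := by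
  classical
  refine ⟨{ij ∈ Finset.Icc 1 (2 * N) ×ˢ Finset.Icc 1 (2 * N) |
      (INcell N ij.1 ij.2 ∩ Rset a₁ b₁ a₂ b₂).Nonempty}, Finset.filter_subset _ _, ?_,
    DiagStripPlus (a₁ - 2 / N) (2 / N), DiagStripPlus b₁ (2 / N),
    DiagStripMinus (a₂ - 2 / N) (2 / N), DiagStripMinus b₂ (2 / N),
    ⟨_, .inl rfl⟩, ⟨_, .inl rfl⟩, ⟨_, .inr rfl⟩, ⟨_, .inr rfl⟩, ?_⟩
  · intro p hp
    obtain ⟨ij, hij, hpij⟩ := exists_mem_INcell hN hp.1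
    exact Set.mem_biUnion (Finset.mem_filter.mpr ⟨hij, p, hpij, hp⟩) hpij
  · rintro p ⟨hpX, hpR⟩
    obtain ⟨⟨i, j⟩, hij, hsq, hp⟩ := Set.mem_iUnion₂.mp hpX
    obtain ⟨-, q, ⟨-, hq⟩, -, hqR⟩ := Finset.mem_filter.mp hij
    have hw : (0 : ℝ) < 1 / N := one_div_pos.mpr (Nat.cast_pos.mpr hN)
    have h2 : (2 : ℝ) / N = 1 / N + 1 / N := by ring
    simp only [sub_div] at hp hq
    simp only [Set.mem_union, DiagStripPlus, DiagStripMinus, Set.mem_ofPred_eq, h2]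
    by_cases h₁ : a₁ ≤ p.1 + p.2
    · by_cases h₂ : p.1 + p.2 ≤ b₁
      · by_cases h₃ : a₂ ≤ p.2 - p.1
        · have h₄ : b₂ < p.2 - p.1 := not_le.mp fun h => hpR ⟨hsq, ⟨h₁, h₂⟩, h₃, h⟩
          exact .inr ⟨by linarith, by linarith⟩
        · exact .inl (.inr ⟨by linarith, by linarith⟩)
      · exact .inl (.inl (.inr ⟨by linarith, by linarith⟩))
    · exact .inl (.inl (.inl ⟨by linarith, by linarith⟩))

end
end
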